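/- Let q ≥ 1 and suppose either p ∈ [q+1, 2q+1) ∩ [2q−2, 4q−2] or p = q+1, and let L > 0. Then for every γ ∈ W^{1,1}_{i,r}(𝕋, ℝ^n) with L(γ) = L one has TP^{(p,q)}(γ) ≥ L^{q+2−p} · π^{p−q} · ∫₀¹ sin(πw)^{2q−p} dw = L^{q+2−p} · π^{p−q} · Γ((2q−p+1)/2) / (√π · Γ((2q−p+2)/2)), where Γ denotes the Gamma function. Moreover, equality holds if the image of γ is a round circle. -/

import Mathlib

open MeasureTheory Real Set intervalIntegral
open scoped ENNReal RealInnerProductSpace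

noncomputable section

/-- A closed `W^{1,1}`-curve on the torus `𝕋 = ℝ/ℤ` with values in `ℝⁿ`, encoded as a
`1`-periodic absolutely continuous function `toFun : ℝ → ℝⁿ` together with its
(weak) derivative `deriv'`. -/
structure ClosedCurve (n : ℕ) where
  toFun : ℝ → EuclideanSpace ℝ (Fin n)
  deriv' : ℝ → EuclideanSpace ℝ (Fin n)
  periodic : Function.Periodic toFun 1
  deriv'_periodic : Function.Periodic deriv' 1
  integrableOn : MeasureTheory.IntegrableOn deriv' (Set.Icc (0:ℝ) 1)
  eq_integral : ∀ t : ℝ, toFun t = toFun 0 + ∫ s in (0:ℝ)..t, deriv' s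

namespace ClosedCurve

variable {n : ℕ}

/-- Injectivity as a map on the torus `ℝ/ℤ`. -/
def IsInj (γ : ClosedCurve n) : Prop :=
  ∀ s t : ℝ, γ.toFun s = γ.toFun t → ∃ k : ℤ, s - t = (k : ℝ)

/-- Regularity: the derivative does not vanish a.e. -/
def IsRegular (γ : ClosedCurve n) : Prop := ∀ᵐ t : ℝ ∂volume, γ.deriv' t ≠ 0

/-- Parametrization by arc length: `|γ'| = 1` a.e. -/
def IsArclength (γ : ClosedCurve n) : Prop := ∀ᵐ t : ℝ ∂volume, ‖γ.deriv' t‖ = 1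

/-- The length of a closed curve. -/
def length (γ : ClosedCurve n) : ℝ := ∫ t in (0:ℝ)..1, ‖γ.deriv' t‖

end ClosedCurve

/-- Orthogonal projection onto the orthogonal complement of `span {v}` (for `v ≠ 0`). -/
def projPerp {F : Type*} [NormedAddCommGroup F] [InnerProductSpace ℝ F] (v x : F) : F :=
  x - (⟪v, x⟫ / ‖v‖ ^ 2) • v

/-- The Gauss map `φ_γ(u,w)`: the unit secant direction. -/
def gaussMap {n : ℕ} (γ : ClosedCurve n) (u w : ℝ) : EuclideanSpace ℝ (Fin n) :=
  ‖γ.toFun (u + w) - γ.toFun u‖⁻¹ • (γ.toFun (u + w) - γ.toFun u)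

/-- `|∂_u φ_γ(u,w)|`, expressed via the identity (1.8) of the paper. -/
def gaussDerivU {n : ℕ} (γ : ClosedCurve n) (u w : ℝ) : ℝ :=
  ‖projPerp (gaussMap γ u w) (γ.deriv' (u + w) - γ.deriv' u)‖ /
    ‖γ.toFun (u + w) - γ.toFun u‖

/-- `|∂_w φ_γ(u,w)|`, expressed via the identity (1.7) of the paper. -/
def gaussDerivW {n : ℕ} (γ : ClosedCurve n) (u w : ℝ) : ℝ :=
  ‖projPerp (gaussMap γ u w) (γ.deriv' (u + w))‖ / ‖γ.toFun (u + w) - γ.toFun u‖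

/-- The generalized tangent-point energy `TP^{(p,q)}` (with values in `[0,∞]`). -/
def TP {n : ℕ} (p q : ℝ) (γ : ClosedCurve n) : ℝ≥0∞ :=
  ∫⁻ u in Set.Ioc (0:ℝ) 1, ∫⁻ w in Set.Ioc (0:ℝ) 1,
    ENNReal.ofReal
      (‖projPerp (γ.deriv' u) (γ.toFun (u + w) - γ.toFun u)‖ ^ q /
        ‖γ.toFun (u + w) - γ.toFun u‖ ^ p * (‖γ.deriv' u‖ * ‖γ.deriv' (u + w)‖))

/-- The minorant `G^{(p,q)}_w`. -/
def Gw {n : ℕ} (p q : ℝ) (γ : ClosedCurve n) (w : ℝ) : ℝ≥0∞ :=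
  ∫⁻ u in Set.Ioc (0:ℝ) 1,
    ENNReal.ofReal ((1/2 * gaussDerivU γ u w) ^ q *
      ‖γ.toFun (u + w) - γ.toFun u‖ ^ (2*q - p))

/-- The minorant `G^{(p,q)}`. -/
def G {n : ℕ} (p q : ℝ) (γ : ClosedCurve n) : ℝ≥0∞ :=
  ∫⁻ w in Set.Ioc (0:ℝ) 1, Gw p q γ w

/-- A round circle in a euclidean space: a sphere intersected with a 2-dimensional plane
through its center. -/
def IsCircle {F : Type*} [NormedAddCommGroup F] [InnerProductSpace ℝ F] (S : Set F) : Prop :=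
  ∃ (c : F) (r : ℝ) (V : Submodule ℝ F), 0 < r ∧ Module.finrank ℝ V = 2 ∧
    S = {x | ‖x - c‖ = r ∧ x - c ∈ V}

/-- A great circle of the unit sphere. -/
def IsGreatCircle {F : Type*} [NormedAddCommGroup F] [InnerProductSpace ℝ F]
    (S : Set F) : Prop :=
  ∃ V : Submodule ℝ F, Module.finrank ℝ V = 2 ∧ S = {x | ‖x‖ = 1 ∧ x ∈ V}

/-- Half of a great circle of the unit sphere: a great-circle arc of angular length `π`. -/
def IsHalfGreatCircle {F : Type*} [NormedAddCommGroup F] [InnerProductSpace ℝ F]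
    (S : Set F) : Prop :=
  ∃ a b : F, ‖a‖ = 1 ∧ ‖b‖ = 1 ∧ ⟪a, b⟫ = 0 ∧
    S = (fun t : ℝ => Real.cos t • a + Real.sin t • b) '' Set.Icc 0 π

/-- A curve is convex if its image is the boundary (within its affine hull) of a convex
planar (2-dimensional) set. -/
def ClosedCurve.IsConvex {n : ℕ} (γ : ClosedCurve n) : Prop :=
  ∃ K : Set (EuclideanSpace ℝ (Fin n)), Convex ℝ K ∧
    Module.finrank ℝ (affineSpan ℝ K).direction = 2 ∧
    Set.range γ.toFun = intrinsicFrontier ℝ K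

/-- Fundamental theorem of calculus for an absolutely continuous vector-valued function with an
essentially bounded derivative. -/
theorem integral_eq_sub_of_ae_hasDerivAt {F : Type*} [NormedAddCommGroup F] [NormedSpace ℝ F]
    [CompleteSpace F] {f f' : ℝ → F} {a b C : ℝ} (hf : AbsolutelyContinuousOnInterval f a b)
    (hf' : IntervalIntegrable f' volume a b) (hC : ∀ x, ‖f' x‖ ≤ C)
    (h : ∀ᵐ x, x ∈ uIcc a b → HasDerivAt f (f' x) x) :
    ∫ x in a..b, f' x = f b - f a := by
  have hsub : ∀ x ∈ uIcc a b, ∀ y ∈ uIcc a b, IntervalIntegrable f' volume x y := fun x hx y hy =>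
    hf'.mono_set (uIcc_subset_uIcc hx hy)
  have hlip : LipschitzOnWith (Real.toNNReal C) (fun x => ∫ s in a..x, f' s) (uIcc a b) := by
    refine LipschitzOnWith.of_dist_le_mul fun x hx y hy => ?_
    rw [dist_eq_norm, intervalIntegral.integral_interval_sub_left (hsub _ left_mem_uIcc _ hx)
      (hsub _ left_mem_uIcc _ hy), Real.dist_eq, abs_sub_comm]
    refine (intervalIntegral.norm_integral_le_of_norm_le_const fun x _ =>
      (hC x).trans (Real.le_coe_toNNReal C)).trans_eq ?_
    rw [abs_sub_comm]
  have hac := hf.sub hlip.absolutelyContinuousOnInterval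
  obtain ⟨K, hK⟩ := hac.const_of_ae_hasDerivAt_zero (by
    filter_upwards [h, hf'.ae_hasDerivAt_integral] with x h1 h2 hx
    simpa using (h1 hx).sub (h2 hx a left_mem_uIcc))
  have h1 := hK a left_mem_uIcc
  have h2 := hK b right_mem_uIcc
  simp only [Pi.sub_apply, intervalIntegral.integral_same, sub_zero] at h1 h2
  rw [h1, ← h2]
  abel

theorem continuous_abs_cos_rpow {a : ℝ} (ha : 0 ≤ a) : Continuous fun x : ℝ => |cos x| ^ a :=
  (continuous_cos.abs).rpow_const fun _ => Or.inr ha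

/-- A weighted version of the fact that the total variation of an angle is at least the
difference of its boundary values. -/
theorem abs_integral_cos_rpow_arcsin_le {c ρ : ℝ → ℝ} {s t a : ℝ} {K : NNReal} (hst : s ≤ t)
    (ha : 0 ≤ a) (hc : LipschitzOnWith K c (Icc s t)) (hb : ∀ x ∈ Icc s t, |c x| ≤ 1)
    (hρ : IntervalIntegrable ρ volume s t) (hρ0 : ∀ x, 0 ≤ ρ x)
    (hd : ∀ᵐ x, x ∈ Icc s t → ∃ c', HasDerivAt c c' x ∧ |c'| ≤ √(1 - c x ^ 2) * ρ x) :
    |∫ θ in arcsin (c s)..arcsin (c t), |cos θ| ^ a| ≤ ∫ x in s..t, √(1 - c x ^ 2) ^ a * ρ x := by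
  have hcc : ContinuousOn c (Icc s t) := hc.continuousOn
  have hcos := continuous_abs_cos_rpow ha
  have key : ∀ l ∈ Ioo (0 : ℝ) 1, |∫ θ in arcsin (l * c s)..arcsin (l * c t), |cos θ| ^ a| ≤
      ∫ x in s..t, √(1 - (l * c x) ^ 2) ^ a * ρ x := by
    intro l hl
    have hlc : ∀ x ∈ Icc s t, l * c x ∈ Icc (-l) l := fun x hx => by
      have := abs_le.1 (hb x hx)
      constructor <;> nlinarith [hl.1]
    let Φ : ℝ → ℝ := fun y => ∫ θ in (0 : ℝ)..arcsin y, |cos θ| ^ a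
    have hΦ : ∀ y ∈ Icc (-l) l, HasDerivAt Φ (√(1 - y ^ 2) ^ a * (1 / √(1 - y ^ 2))) y := by
      intro y hy
      have h1 : HasDerivAt arcsin (1 / √(1 - y ^ 2)) y :=
        Real.hasDerivAt_arcsin (by linarith [hy.1, hl.2]) (by linarith [hy.2, hl.2])
      have h2 : HasDerivAt (fun z : ℝ => ∫ θ in (0 : ℝ)..z, |cos θ| ^ a) (|cos (arcsin y)| ^ a)
          (arcsin y) := intervalIntegral.integral_hasDerivAt_right (hcos.intervalIntegrable _ _)
            (hcos.stronglyMeasurableAtFilter _ _) hcos.continuousAt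
      have := h2.comp y h1
      rwa [cos_arcsin, abs_of_nonneg (Real.sqrt_nonneg _)] at this
    have hpos : ∀ y ∈ Icc (-l) l, 0 < 1 - y ^ 2 := fun y hy => by
      nlinarith [hy.1, hy.2, hl.1, hl.2]
    have hlip : ∃ M : NNReal, LipschitzOnWith M Φ (Icc (-l) l) := by
      refine ⟨Real.toNNReal (1 / √(1 - l ^ 2)),
        (convex_Icc (-l) l).lipschitzOnWith_of_nnnorm_hasDerivWithin_le
          (fun y hy => (hΦ y hy).hasDerivWithinAt) fun y hy => ?_⟩
      rw [← NNReal.coe_le_coe, coe_nnnorm]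
      refine le_trans ?_ (Real.le_coe_toNNReal _)
      have hl2 : 0 < 1 - l ^ 2 := hpos l ⟨by linarith [hl.1], le_rfl⟩
      have hy2 := hpos y hy
      rw [Real.norm_of_nonneg (by positivity)]
      have h1 : √(1 - y ^ 2) ^ a ≤ 1 := Real.rpow_le_one (Real.sqrt_nonneg _)
        (Real.sqrt_le_one.2 (by nlinarith)) ha
      have h2 : √(1 - l ^ 2) ≤ √(1 - y ^ 2) := Real.sqrt_le_sqrt (by
        nlinarith [hy.1, hy.2])
      have h3 : 0 < √(1 - l ^ 2) := Real.sqrt_pos.2 hl2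
      calc _ ≤ 1 * (1 / √(1 - y ^ 2)) := by gcongr
        _ ≤ _ := by rw [one_mul]; gcongr
    obtain ⟨M, hM⟩ := hlip
    have hlcl : LipschitzOnWith (Real.toNNReal l * K) (fun x => l * c x) (Icc s t) := by
      refine LipschitzOnWith.of_dist_le_mul fun x hx y hy => ?_
      have := hc.dist_le_mul x hx y hy
      rw [Real.dist_eq] at this ⊢
      rw [← mul_sub, abs_mul, abs_of_pos hl.1, NNReal.coe_mul, Real.coe_toNNReal _ hl.1.le,
        mul_assoc]
      exact mul_le_mul_of_nonneg_left this hl.1.le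
    have hcomp := hM.comp hlcl hlc
    have hac : AbsolutelyContinuousOnInterval (Φ ∘ fun x => l * c x) s t := by
      refine LipschitzOnWith.absolutelyContinuousOnInterval (K := M * (Real.toNNReal l * K)) ?_
      rwa [uIcc_of_le hst]
    have hint := hac.integral_deriv_eq_sub
    have hend : ∫ θ in arcsin (l * c s)..arcsin (l * c t), |cos θ| ^ a =
        (Φ ∘ fun x => l * c x) t - (Φ ∘ fun x => l * c x) s := by
      simp only [Φ, Function.comp]
      rw [intervalIntegral.integral_interval_sub_left (hcos.intervalIntegrable _ _)
        (hcos.intervalIntegrable _ _)]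
    rw [hend, ← hint, ← Real.norm_eq_abs]
    refine intervalIntegral.norm_integral_le_of_norm_le hst ?_ ?_
    · filter_upwards [hd] with x hx hxm
      obtain ⟨c', hc', hle⟩ := hx (Ioc_subset_Icc_self hxm)
      have hxl := hlc x (Ioc_subset_Icc_self hxm)
      have hD : HasDerivAt (Φ ∘ fun x => l * c x)
          (√(1 - (l * c x) ^ 2) ^ a * (1 / √(1 - (l * c x) ^ 2)) * (l * c')) x :=
        (hΦ _ hxl).comp x (hc'.const_mul l)
      have hp := hpos _ hxl
      have hs : 0 < √(1 - (l * c x) ^ 2) := Real.sqrt_pos.2 hp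
      rw [hD.deriv, mul_assoc, norm_mul, Real.norm_of_nonneg (by positivity)]
      gcongr
      rw [Real.norm_eq_abs, abs_mul, abs_mul, abs_of_pos hl.1, abs_of_pos (by positivity),
        one_div, inv_mul_le_iff₀ hs]
      calc l * |c'| ≤ l * (√(1 - c x ^ 2) * ρ x) := by gcongr; exact hl.1.le
        _ = (l * √(1 - c x ^ 2)) * ρ x := by ring
        _ ≤ _ := by
          refine mul_le_mul_of_nonneg_right ?_ (hρ0 x)
          refine Real.le_sqrt_of_sq_le ?_
          have hc1 : 0 ≤ 1 - c x ^ 2 := by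
            have := (sq_le_one_iff_abs_le_one _).2 (hb x (Ioc_subset_Icc_self hxm))
            linarith
          rw [mul_pow, Real.sq_sqrt hc1]
          nlinarith [hl.1, hl.2]
    · refine hρ.continuousOn_mul ?_
      rw [uIcc_of_le hst]
      refine ContinuousOn.rpow_const ?_ fun _ _ => Or.inr ha
      exact Real.continuous_sqrt.comp_continuousOn
        (continuousOn_const.sub ((continuousOn_const.mul hcc).pow 2))
  have hlim : Filter.Tendsto (fun l : ℝ => l) (nhdsWithin 1 (Iio 1)) (nhds 1) :=
    tendsto_nhdsWithin_of_tendsto_nhds Filter.tendsto_id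
  have hev : ∀ᶠ l in nhdsWithin (1 : ℝ) (Iio 1), l ∈ Ioo (0 : ℝ) 1 :=
    Ioo_mem_nhdsLT (by norm_num)
  have hL : Filter.Tendsto (fun l : ℝ => |∫ θ in arcsin (l * c s)..arcsin (l * c t), |cos θ| ^ a|)
      (nhdsWithin 1 (Iio 1)) (nhds |∫ θ in arcsin (c s)..arcsin (c t), |cos θ| ^ a|) := by
    have hcont : Continuous fun l : ℝ =>
        |∫ θ in arcsin (l * c s)..arcsin (l * c t), |cos θ| ^ a| := by
      have hprim : Continuous fun z : ℝ => ∫ θ in (0 : ℝ)..z, |cos θ| ^ a :=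
        intervalIntegral.continuous_primitive (fun _ _ => hcos.intervalIntegrable _ _) 0
      have heq : (fun l : ℝ => |∫ θ in arcsin (l * c s)..arcsin (l * c t), |cos θ| ^ a|) =
          fun l => |(∫ θ in (0 : ℝ)..arcsin (l * c t), |cos θ| ^ a) -
            ∫ θ in (0 : ℝ)..arcsin (l * c s), |cos θ| ^ a| := by
        funext l
        rw [intervalIntegral.integral_interval_sub_left (hcos.intervalIntegrable _ _)
          (hcos.intervalIntegrable _ _)]
      rw [heq]
      exact ((hprim.comp (Real.continuous_arcsin.comp (continuous_id.mul continuous_const))).sub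
        (hprim.comp (Real.continuous_arcsin.comp (continuous_id.mul continuous_const)))).abs
    have := (hcont.tendsto 1).comp hlim
    simpa [Function.comp_def] using this
  have hR : Filter.Tendsto (fun l : ℝ => ∫ x in s..t, √(1 - (l * c x) ^ 2) ^ a * ρ x)
      (nhdsWithin 1 (Iio 1)) (nhds (∫ x in s..t, √(1 - c x ^ 2) ^ a * ρ x)) := by
    refine intervalIntegral.tendsto_integral_filter_of_dominated_convergence ρ ?_ ?_ hρ ?_
    · refine Filter.Eventually.of_forall fun l => ?_
      have : IntervalIntegrable (fun x => √(1 - (l * c x) ^ 2) ^ a * ρ x) volume s t := by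
        refine hρ.continuousOn_mul ?_
        rw [uIcc_of_le hst]
        refine ContinuousOn.rpow_const ?_ fun _ _ => Or.inr ha
        exact Real.continuous_sqrt.comp_continuousOn
          (continuousOn_const.sub ((continuousOn_const.mul hcc).pow 2))
      exact this.def'.aestronglyMeasurable
    · refine Filter.Eventually.of_forall fun l => Filter.Eventually.of_forall fun x _ => ?_
      rw [Real.norm_of_nonneg (mul_nonneg (by positivity) (hρ0 x))]
      refine mul_le_of_le_one_left (hρ0 x) (Real.rpow_le_one (Real.sqrt_nonneg _) ?_ ha)
      exact Real.sqrt_le_one.2 (by nlinarith [sq_nonneg (l * c x)])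
    · refine Filter.Eventually.of_forall fun x _ => ?_
      have hcont : Continuous fun l : ℝ => √(1 - (l * c x) ^ 2) ^ a * ρ x := by
        refine Continuous.mul (Continuous.rpow_const ?_ fun _ => Or.inr ha) continuous_const
        fun_prop
      have := (hcont.tendsto 1).comp hlim
      simpa [Function.comp_def] using this
  exact le_of_tendsto_of_tendsto hL hR (hev.mono key)

/-- The derivative of the cosine of the angle between a fixed unit vector and a moving direction. -/
theorem exists_hasDerivAt_inner_div_norm {F : Type*} [NormedAddCommGroup F]
    [InnerProductSpace ℝ F] {D : ℝ → F} {d e : F} {x : ℝ} (hD : HasDerivAt D d x)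
    (h0 : D x ≠ 0) (he : ‖e‖ = 1) :
    ∃ c', HasDerivAt (fun y => ⟪e, D y⟫ / ‖D y‖) c' x ∧
      |c'| ≤ √(1 - (⟪e, D x⟫ / ‖D x‖) ^ 2) * (‖d - (⟪D x, d⟫ / ‖D x‖ ^ 2) • D x‖ / ‖D x‖) := by
  have hn : 0 < ‖D x‖ := norm_pos_iff.2 h0
  have h1 : HasDerivAt (fun y => ⟪e, D y⟫) ⟪e, d⟫ x := by
    simpa using (hasDerivAt_const x e).inner ℝ hD
  have h2 : HasDerivAt (fun y => ‖D y‖) (⟪D x, d⟫ / ‖D x‖) x := by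
    have h3 := hD.norm_sq.sqrt (by positivity)
    have h4 : (fun y => √(‖D y‖ ^ 2)) = fun y => ‖D y‖ := by
      funext y; exact Real.sqrt_sq (norm_nonneg _)
    rw [h4, Real.sqrt_sq hn.le] at h3
    convert h3 using 1
    field_simp
  refine ⟨_, h1.div h2 hn.ne', ?_⟩
  set c := ⟪e, D x⟫ / ‖D x‖ with hc
  have hinner : ⟪e, D x⟫ = c * ‖D x‖ := by rw [hc]; field_simp
  have hval : (⟪e, d⟫ * ‖D x‖ - ⟪e, D x⟫ * (⟪D x, d⟫ / ‖D x‖)) / ‖D x‖ ^ 2 =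
      ⟪e - (c / ‖D x‖) • D x, d - (⟪D x, d⟫ / ‖D x‖ ^ 2) • D x⟫ / ‖D x‖ := by
    simp only [inner_sub_left, inner_sub_right, inner_smul_left, inner_smul_right,
      real_inner_self_eq_norm_sq, hinner]
    simp only [conj_trivial]
    field_simp
    ring
  have hnorm : ‖e - (c / ‖D x‖) • D x‖ = √(1 - c ^ 2) := by
    rw [eq_comm, Real.sqrt_eq_iff_eq_sq _ (norm_nonneg _), norm_sub_sq_real, he, inner_smul_right,
      hinner, norm_smul, Real.norm_eq_abs, mul_pow, sq_abs]
    · field_simp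
      ring
    · have h5 : |⟪e, D x⟫| ≤ ‖D x‖ := by simpa [he] using abs_real_inner_le_norm e (D x)
      have h6 : |c| ≤ 1 := by
        rw [hc, abs_div, abs_of_pos hn]
        exact div_le_one_of_le₀ h5 hn.le
      linarith [(sq_le_one_iff_abs_le_one _).2 h6]
  rw [hval, abs_div, abs_of_pos hn, ← hnorm, ← mul_div_assoc]
  gcongr
  exact abs_real_inner_le_norm _ _

theorem abs_inner_div_norm_le_one {F : Type*} [NormedAddCommGroup F] [InnerProductSpace ℝ F]
    {e : F} (he : ‖e‖ = 1) (x : F) : |⟪e, x⟫ / ‖x‖| ≤ 1 := by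
  rw [abs_div, abs_norm]
  exact div_le_one_of_le₀ (by simpa [he] using abs_real_inner_le_norm e x) (norm_nonneg _)

theorem abs_inner_div_norm_sub_le {F : Type*} [NormedAddCommGroup F] [InnerProductSpace ℝ F]
    {e x y : F} (he : ‖e‖ = 1) (hx : x ≠ 0) (hy : y ≠ 0) :
    |⟪e, x⟫ / ‖x‖ - ⟪e, y⟫ / ‖y‖| ≤ 2 / ‖x‖ * ‖x - y‖ := by
  have hx' : 0 < ‖x‖ := norm_pos_iff.2 hx
  have hy' : 0 < ‖y‖ := norm_pos_iff.2 hy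
  have heq : ⟪e, x⟫ / ‖x‖ - ⟪e, y⟫ / ‖y‖ =
      (⟪e, x - y⟫ + (⟪e, y⟫ / ‖y‖) * (‖y‖ - ‖x‖)) / ‖x‖ := by
    rw [inner_sub_right]; field_simp; ring
  rw [heq, abs_div, abs_of_pos hx', div_mul_eq_mul_div 2]
  refine div_le_div_of_nonneg_right ?_ hx'.le
  refine (abs_add_le _ _).trans ?_
  have h1 : |⟪e, x - y⟫| ≤ ‖x - y‖ := by simpa [he] using abs_real_inner_le_norm e (x - y)
  have h2 : |⟪e, y⟫ / ‖y‖ * (‖y‖ - ‖x‖)| ≤ ‖x - y‖ := by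
    rw [abs_mul]
    calc _ ≤ 1 * ‖x - y‖ := by
          refine mul_le_mul (abs_inner_div_norm_le_one he y) ?_ (abs_nonneg _) zero_le_one
          rw [norm_sub_rev x y]; exact abs_norm_sub_norm_le y x
      _ = _ := one_mul _
  linarith

theorem abs_integral_cos_rpow_direction_le {F : Type*} [NormedAddCommGroup F]
    [InnerProductSpace ℝ F] {D d : ℝ → F} {e : F} {ρ : ℝ → ℝ} {s t a : ℝ} {M : NNReal}
    (hst : s ≤ t) (ha : 0 ≤ a) (hD : LipschitzWith M D) (h0 : ∀ x ∈ Icc s t, D x ≠ 0)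
    (he : ‖e‖ = 1) (hρ : IntervalIntegrable ρ volume s t) (hρ0 : ∀ x, 0 ≤ ρ x)
    (hd : ∀ᵐ x, HasDerivAt D (d x) x)
    (hle : ∀ x ∈ Icc s t, ‖d x - (⟪D x, d x⟫ / ‖D x‖ ^ 2) • D x‖ / ‖D x‖ ≤ ρ x) :
    |∫ θ in arcsin (⟪e, D s⟫ / ‖D s‖)..arcsin (⟪e, D t⟫ / ‖D t‖), |cos θ| ^ a| ≤
      ∫ x in s..t, √(1 - (⟪e, D x⟫ / ‖D x‖) ^ 2) ^ a * ρ x := by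
  obtain ⟨x₀, hx₀, hmin⟩ := isCompact_Icc.exists_isMinOn (nonempty_Icc.2 hst)
    (hD.continuous.norm.continuousOn (s := Icc s t))
  have hδ : 0 < ‖D x₀‖ := norm_pos_iff.2 (h0 x₀ hx₀)
  have hlip : LipschitzOnWith (Real.toNNReal (2 / ‖D x₀‖ * M)) (fun x => ⟪e, D x⟫ / ‖D x‖)
      (Icc s t) := by
    refine LipschitzOnWith.of_dist_le_mul fun x hx y hy => ?_
    rw [Real.coe_toNNReal _ (by positivity), Real.dist_eq, mul_assoc]
    refine (abs_inner_div_norm_sub_le he (h0 x hx) (h0 y hy)).trans ?_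
    have hx1 : ‖D x₀‖ ≤ ‖D x‖ := hmin hx
    have := hD.dist_le_mul x y
    rw [dist_eq_norm (D x)] at this
    exact mul_le_mul (div_le_div_of_nonneg_left zero_le_two hδ hx1) this (norm_nonneg _)
      (by positivity)
  refine abs_integral_cos_rpow_arcsin_le (c := fun x => ⟪e, D x⟫ / ‖D x‖) hst ha hlip
    (fun x _ => abs_inner_div_norm_le_one he _) hρ hρ0 ?_
  filter_upwards [hd] with x hx hxm
  obtain ⟨c', h1, h2⟩ := exists_hasDerivAt_inner_div_norm hx (h0 x hxm) he
  exact ⟨c', h1, h2.trans (mul_le_mul_of_nonneg_left (hle x hxm) (Real.sqrt_nonneg _))⟩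

/-- A closed embedded curve of length one, parametrized by arc length. -/
structure UnitLoop (n : ℕ) where
  pos : ℝ → EuclideanSpace ℝ (Fin n)
  vel : ℝ → EuclideanSpace ℝ (Fin n)
  pos_periodic : Function.Periodic pos 1
  vel_periodic : Function.Periodic vel 1
  measurable_vel : Measurable vel
  norm_vel : ∀ t, ‖vel t‖ = 1
  integral_vel : ∀ s t, ∫ x in s..t, vel x = pos t - pos s
  exists_int_of_pos_eq : ∀ s t, pos s = pos t → ∃ k : ℤ, s - t = k

namespace UnitLoop

variable {n : ℕ} (γ : UnitLoop n)

/-- The distance between two points of the curve. -/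
def chord (u v : ℝ) : ℝ := ‖γ.pos v - γ.pos u‖

/-- The sine of the angle between the secant through two points and the tangent at the first. -/
def sinAngle (u v : ℝ) : ℝ := √(1 - (⟪γ.vel u, γ.pos v - γ.pos u⟫ / ‖γ.pos v - γ.pos u‖) ^ 2)

theorem lipschitzWith_pos : LipschitzWith 1 γ.pos := by
  refine LipschitzWith.of_dist_le_mul fun s t => ?_
  rw [dist_eq_norm, ← γ.integral_vel t s, NNReal.coe_one, Real.dist_eq]
  exact intervalIntegral.norm_integral_le_of_norm_le_const fun x _ => (γ.norm_vel x).le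

theorem continuous_pos : Continuous γ.pos := γ.lipschitzWith_pos.continuous

theorem locallyIntegrable_vel : LocallyIntegrable γ.vel volume :=
  (locallyIntegrable_const (1 : ℝ)).mono γ.measurable_vel.aestronglyMeasurable
    (Filter.Eventually.of_forall fun x => by simp [γ.norm_vel x])

theorem ae_hasDerivAt_pos : ∀ᵐ t, HasDerivAt γ.pos (γ.vel t) t := by
  filter_upwards [LocallyIntegrable.ae_hasDerivAt_integral γ.locallyIntegrable_vel] with t ht
  have h : γ.pos = fun x => (∫ s in (0 : ℝ)..x, γ.vel s) + γ.pos 0 := by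
    funext x; rw [γ.integral_vel, sub_add_cancel]
  rw [h]
  exact (ht 0).add_const _

theorem pos_ne {u v : ℝ} (h1 : u < v) (h2 : v < u + 1) : γ.pos v - γ.pos u ≠ 0 := by
  intro h
  obtain ⟨k, hk⟩ := γ.exists_int_of_pos_eq v u (sub_eq_zero.1 h)
  have h3 : (0 : ℝ) < k := by linarith
  have h4 : (k : ℝ) < 1 := by linarith
  have h5 : (0 : ℤ) < k := by exact_mod_cast h3
  have h6 : k < (1 : ℤ) := by exact_mod_cast h4
  omega

theorem chord_nonneg (u v : ℝ) : 0 ≤ γ.chord u v := norm_nonneg _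

theorem chord_pos {u v : ℝ} (h1 : u < v) (h2 : v < u + 1) : 0 < γ.chord u v :=
  norm_pos_iff.2 (γ.pos_ne h1 h2)

theorem chord_comm (u v : ℝ) : γ.chord u v = γ.chord v u := norm_sub_rev _ _

theorem continuous_chord : Continuous fun p : ℝ × ℝ => γ.chord p.1 p.2 := by
  unfold chord
  exact ((γ.continuous_pos.comp continuous_snd).sub (γ.continuous_pos.comp continuous_fst)).norm

theorem sinAngle_nonneg (u v : ℝ) : 0 ≤ γ.sinAngle u v := Real.sqrt_nonneg _

theorem sinAngle_le_one (u v : ℝ) : γ.sinAngle u v ≤ 1 :=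
  Real.sqrt_le_one.2 (by nlinarith [sq_nonneg (⟪γ.vel u, γ.pos v - γ.pos u⟫ / ‖γ.pos v - γ.pos u‖)])

theorem measurable_sinAngle {X : Type*} [MeasurableSpace X] {f g : X → ℝ} (hf : Measurable f)
    (hg : Measurable g) : Measurable fun x => γ.sinAngle (f x) (g x) := by
  unfold sinAngle
  have h1 : Measurable fun x => γ.vel (f x) := γ.measurable_vel.comp hf
  have h2 : Measurable fun x => γ.pos (g x) - γ.pos (f x) :=
    (γ.continuous_pos.measurable.comp hg).sub (γ.continuous_pos.measurable.comp hf)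
  exact (measurable_const.sub (((h1.inner h2).div h2.norm).pow_const 2)).sqrt

theorem norm_vel_sub_proj {u v : ℝ} (h : γ.pos v - γ.pos u ≠ 0) :
    ‖γ.vel u - (⟪γ.pos v - γ.pos u, γ.vel u⟫ / ‖γ.pos v - γ.pos u‖ ^ 2) • (γ.pos v - γ.pos u)‖ =
      γ.sinAngle u v := by
  have hn : 0 < ‖γ.pos v - γ.pos u‖ := norm_pos_iff.2 h
  have h1 := (sq_le_one_iff_abs_le_one _).2
    (abs_inner_div_norm_le_one (γ.norm_vel u) (γ.pos v - γ.pos u))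
  rw [sinAngle, eq_comm, Real.sqrt_eq_iff_eq_sq (by linarith) (norm_nonneg _), norm_sub_sq_real,
    γ.norm_vel, inner_smul_right, norm_smul, Real.norm_eq_abs, mul_pow, sq_abs, real_inner_comm]
  field_simp
  ring

theorem norm_vel_sub_proj' {u v : ℝ} (h : γ.pos v - γ.pos u ≠ 0) :
    ‖γ.vel v - (⟪γ.pos v - γ.pos u, γ.vel v⟫ / ‖γ.pos v - γ.pos u‖ ^ 2) • (γ.pos v - γ.pos u)‖ =
      γ.sinAngle v u := by
  have h' : γ.pos u - γ.pos v ≠ 0 := by rwa [← neg_sub, neg_ne_zero]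
  rw [← γ.norm_vel_sub_proj h', ← neg_sub (γ.pos v), inner_neg_left, norm_neg, neg_div, neg_smul,
    smul_neg, neg_neg]

theorem intervalIntegrable_of_continuous_chord {ψ : ℝ → ℝ} {x y : ℝ → ℝ} {s t C : ℝ}
    (hst : s ≤ t) (hx : Continuous x) (hy : Continuous y) (hψ : Measurable ψ)
    (hC : ∀ z, |ψ z| ≤ C) (h0 : ∀ z ∈ Icc s t, 0 < γ.chord (x z) (y z)) :
    IntervalIntegrable (fun z => ψ z / γ.chord (x z) (y z)) volume s t := by
  have h1 : IntervalIntegrable ψ volume s t :=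
    (intervalIntegrable_const (c := C)).mono_fun hψ.aestronglyMeasurable
      (Filter.Eventually.of_forall fun z => by
        simpa using (hC z).trans (le_abs_self C))
  simp only [div_eq_mul_inv]
  refine h1.mul_continuousOn ?_
  rw [uIcc_of_le hst]
  exact (γ.continuous_chord.comp (hx.prodMk hy)).continuousOn.inv₀ fun z hz => (h0 z hz).ne'

theorem abs_integral_cos_rpow_le (u : ℝ) {s t a : ℝ} (hs : u < s) (hst : s ≤ t) (ht : t < u + 1)
    (ha : 0 ≤ a) :
    |∫ θ in arcsin (⟪γ.vel u, γ.pos s - γ.pos u⟫ / ‖γ.pos s - γ.pos u‖)..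
        arcsin (⟪γ.vel u, γ.pos t - γ.pos u⟫ / ‖γ.pos t - γ.pos u‖), |cos θ| ^ a| ≤
      ∫ v in s..t, γ.sinAngle u v ^ a * (γ.sinAngle v u / γ.chord u v) := by
  have h0 : ∀ v ∈ Icc s t, γ.pos v - γ.pos u ≠ 0 := fun v hv =>
    γ.pos_ne (by linarith [hv.1]) (by linarith [hv.2])
  refine abs_integral_cos_rpow_direction_le (D := fun v => γ.pos v - γ.pos u) (d := γ.vel)
    (e := γ.vel u) (ρ := fun v => γ.sinAngle v u / γ.chord u v) (M := 1) hst ha ?_ h0 (γ.norm_vel u) ?_ ?_ ?_ ?_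
  · refine LipschitzWith.of_dist_le_mul fun x y => ?_
    rw [dist_sub_right]
    exact γ.lipschitzWith_pos.dist_le_mul x y
  · refine γ.intervalIntegrable_of_continuous_chord (ψ := fun v => γ.sinAngle v u)
      (x := fun _ => u) (y := fun v => v) (C := 1) hst continuous_const continuous_id
      (γ.measurable_sinAngle measurable_id' measurable_const) (fun z => ?_)
      fun v hv => norm_pos_iff.2 (h0 v hv)
    rw [abs_of_nonneg (γ.sinAngle_nonneg _ _)]
    exact γ.sinAngle_le_one _ _
  · exact fun x => div_nonneg (γ.sinAngle_nonneg _ _) (γ.chord_nonneg _ _)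
  · filter_upwards [γ.ae_hasDerivAt_pos] with x hx using hx.sub_const _
  · intro v hv
    rw [γ.norm_vel_sub_proj' (h0 v hv)]
    exact le_rfl

theorem abs_arcsin_sub_le {e : EuclideanSpace ℝ (Fin n)} (he : ‖e‖ = 1) {w s t : ℝ} (hw : 0 < w)
    (hw1 : w < 1) (hst : s ≤ t) :
    |arcsin (⟪e, γ.pos (t + w) - γ.pos t⟫ / ‖γ.pos (t + w) - γ.pos t‖) -
        arcsin (⟪e, γ.pos (s + w) - γ.pos s⟫ / ‖γ.pos (s + w) - γ.pos s‖)| ≤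
      ∫ x in s..t, (γ.sinAngle x (x + w) + γ.sinAngle (x + w) x) / γ.chord x (x + w) := by
  have h0 : ∀ x, γ.pos (x + w) - γ.pos x ≠ 0 := fun v =>
    γ.pos_ne (by linarith) (by linarith)
  have hm : MeasurePreserving (fun x : ℝ => x + w) volume volume :=
    measurePreserving_add_right volume w
  have hρ0 : ∀ x, 0 ≤ (γ.sinAngle x (x + w) + γ.sinAngle (x + w) x) / γ.chord x (x + w) :=
    fun x => div_nonneg (add_nonneg (γ.sinAngle_nonneg _ _) (γ.sinAngle_nonneg _ _))
      (γ.chord_nonneg _ _)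
  have key := abs_integral_cos_rpow_direction_le (D := fun x => γ.pos (x + w) - γ.pos x)
    (d := fun x => γ.vel (x + w) - γ.vel x) (e := e) (a := 0) (M := 1 + 1)
    (ρ := fun x => (γ.sinAngle x (x + w) + γ.sinAngle (x + w) x) / γ.chord x (x + w))
    hst le_rfl ?_ (fun x _ => h0 x) he ?_ hρ0 ?_ ?_
  · simpa using key
  · refine LipschitzWith.sub (LipschitzWith.of_dist_le_mul fun x y => ?_) γ.lipschitzWith_pos
    simpa using γ.lipschitzWith_pos.dist_le_mul (x + w) (y + w)
  · refine γ.intervalIntegrable_of_continuous_chord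
      (ψ := fun x => γ.sinAngle x (x + w) + γ.sinAngle (x + w) x) (x := fun x => x)
      (y := fun x => x + w) (C := 2) hst continuous_id
      (continuous_id.add continuous_const)
      ((γ.measurable_sinAngle measurable_id' (measurable_id'.add_const w)).add
        (γ.measurable_sinAngle (measurable_id'.add_const w) measurable_id'))
      (fun z => ?_) fun v _ => norm_pos_iff.2 (h0 v)
    rw [abs_of_nonneg (add_nonneg (γ.sinAngle_nonneg _ _) (γ.sinAngle_nonneg _ _))]
    linarith [γ.sinAngle_le_one z (z + w), γ.sinAngle_le_one (z + w) z]
  · filter_upwards [γ.ae_hasDerivAt_pos, hm.quasiMeasurePreserving.ae γ.ae_hasDerivAt_pos]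
      with x h1 h2
    exact (h2.comp_add_const x w).sub h1
  · intro x _
    have hx := h0 x
    refine div_le_div_of_nonneg_right ?_ (norm_nonneg _)
    rw [← γ.norm_vel_sub_proj hx, ← γ.norm_vel_sub_proj' hx]
    refine le_trans (le_of_eq ?_) (norm_sub_le _ _)
    rw [← norm_neg]
    congr 1
    rw [inner_sub_right, sub_div, sub_smul]
    abel

end UnitLoop

theorem ofReal_integral_le_lintegral {X : Type*} [MeasurableSpace X] {μ : Measure X} {f : X → ℝ}
    (hf : AEStronglyMeasurable f μ) (h0 : 0 ≤ᵐ[μ] f) :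
    ENNReal.ofReal (∫ x, f x ∂μ) ≤ ∫⁻ x, ENNReal.ofReal (f x) ∂μ := by
  rw [integral_eq_lintegral_of_nonneg_ae h0 hf]
  exact ENNReal.ofReal_toReal_le

theorem tendsto_inner_div_norm {F : Type*} [NormedAddCommGroup F] [InnerProductSpace ℝ F]
    {ι : Type*} {l : Filter ι} {e : F} {D : ι → F} {r : ι → ℝ} (he : ‖e‖ = 1)
    (hr : ∀ᶠ i in l, 0 < r i) (hD : Filter.Tendsto (fun i => r i • D i) l (nhds e)) :
    Filter.Tendsto (fun i => ⟪e, D i⟫ / ‖D i‖) l (nhds 1) := by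
  have h1 : Filter.Tendsto (fun i => ⟪e, r i • D i⟫ / ‖r i • D i‖) l (nhds (⟪e, e⟫ / ‖e‖)) :=
    (tendsto_const_nhds.inner hD).div hD.norm (by simp [he])
  rw [real_inner_self_eq_norm_sq, he, one_pow, div_one] at h1
  refine h1.congr' ?_
  filter_upwards [hr] with i hi
  rw [inner_smul_right, norm_smul, Real.norm_of_nonneg hi.le, mul_div_mul_left _ _ hi.ne']

namespace UnitLoop

variable {n : ℕ} (γ : UnitLoop n)

theorem ofReal_integral_cos_rpow_le {u a : ℝ} (ha : 0 ≤ a) (hu : HasDerivAt γ.pos (γ.vel u) u) :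
    ENNReal.ofReal (∫ θ in (-(π / 2))..(π / 2), |cos θ| ^ a) ≤
      ∫⁻ v in Ioo u (u + 1),
        ENNReal.ofReal (γ.sinAngle u v ^ a * (γ.sinAngle v u / γ.chord u v)) := by
  have hcos := continuous_abs_cos_rpow ha
  set c : ℝ → ℝ := fun v => ⟪γ.vel u, γ.pos v - γ.pos u⟫ / ‖γ.pos v - γ.pos u‖ with hc
  set F : ℝ → ℝ := fun x => ∫ θ in (0 : ℝ)..x, |cos θ| ^ a with hF
  have hFc : Continuous F := intervalIntegral.continuous_primitive
    (fun x y => hcos.intervalIntegrable x y) 0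
  have hsub : ∀ x y, ∫ θ in x..y, |cos θ| ^ a = F y - F x := fun x y =>
    (intervalIntegral.integral_interval_sub_left (hcos.intervalIntegrable _ _)
      (hcos.intervalIntegrable _ _)).symm
  have hright : Filter.Tendsto (fun ε => c (u + ε)) (nhdsWithin 0 (Ioi 0)) (nhds 1) := by
    refine tendsto_inner_div_norm (r := fun ε => ε⁻¹) (γ.norm_vel u) ?_
      hu.tendsto_slope_zero_right
    filter_upwards [self_mem_nhdsWithin] with ε hε using inv_pos.2 hε
  have hleft : Filter.Tendsto (fun ε => c (u + 1 - ε)) (nhdsWithin 0 (Ioi 0)) (nhds (-1)) := by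
    have h1 : Filter.Tendsto (fun ε : ℝ => -ε) (nhdsWithin 0 (Ioi 0)) (nhdsWithin 0 (Iio 0)) := by
      refine tendsto_nhdsWithin_iff.2 ⟨?_, ?_⟩
      · exact (Continuous.tendsto' continuous_neg 0 0 (by simp)).mono_left nhdsWithin_le_nhds
      · filter_upwards [self_mem_nhdsWithin] with ε hε using neg_lt_zero.2 (mem_Ioi.1 hε)
    have h2 := hu.tendsto_slope_zero_left.comp h1
    have h3 : Filter.Tendsto (fun ε => ⟪γ.vel u, -(γ.pos (u + -ε) - γ.pos u)⟫ /
        ‖-(γ.pos (u + -ε) - γ.pos u)‖) (nhdsWithin 0 (Ioi 0)) (nhds 1) := by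
      refine tendsto_inner_div_norm (r := fun ε => ε⁻¹) (γ.norm_vel u) ?_ (h2.congr fun ε => ?_)
      · filter_upwards [self_mem_nhdsWithin] with ε hε using inv_pos.2 hε
      · rw [Function.comp_apply, inv_neg, neg_smul, smul_neg]
    refine h3.neg.congr fun ε => ?_
    have h4 : γ.pos (u + 1 - ε) = γ.pos (u + -ε) := by
      rw [← γ.pos_periodic (u + -ε)]; congr 1; ring
    simp only [hc, h4, inner_neg_right, norm_neg, neg_div, neg_neg]
  have hlim : Filter.Tendsto (fun ε => ENNReal.ofReal |F (arcsin (c (u + 1 - ε))) -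
      F (arcsin (c (u + ε)))|) (nhdsWithin 0 (Ioi 0))
      (nhds (ENNReal.ofReal (∫ θ in (-(π / 2))..(π / 2), |cos θ| ^ a))) := by
    have hg : Continuous fun x => F (arcsin x) := hFc.comp continuous_arcsin
    have h1 := ((hg.tendsto (-1)).comp hleft).sub ((hg.tendsto 1).comp hright)
    have h2 := (ENNReal.continuous_ofReal.tendsto _).comp h1.abs
    have h3 : |F (arcsin (-1)) - F (arcsin 1)| = ∫ θ in (-(π / 2))..(π / 2), |cos θ| ^ a := by
      rw [arcsin_neg_one, arcsin_one, abs_sub_comm, ← hsub, abs_of_nonneg]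
      exact intervalIntegral.integral_nonneg (by linarith [pi_pos]) fun θ _ => by positivity
    rw [h3] at h2
    exact h2
  refine le_of_tendsto hlim ?_
  have hsmall : ∀ᶠ ε : ℝ in nhdsWithin 0 (Ioi 0), ε < 1 / 2 :=
    nhdsWithin_le_nhds (Iio_mem_nhds (by norm_num))
  filter_upwards [self_mem_nhdsWithin, hsmall] with ε hε hε2
  have hε : 0 < ε := hε
  have hle : u + ε ≤ u + 1 - ε := by linarith
  rw [← hsub]
  refine (ENNReal.ofReal_le_ofReal (γ.abs_integral_cos_rpow_le u (by linarith) hle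
    (by linarith) ha)).trans ?_
  rw [intervalIntegral.integral_of_le hle]
  refine (ofReal_integral_le_lintegral ?_ (Filter.Eventually.of_forall fun v => ?_)).trans
    (lintegral_mono_set fun v hv => ⟨by linarith [hv.1], by linarith [hv.2]⟩)
  · refine Measurable.aestronglyMeasurable ?_
    have h1 := γ.measurable_sinAngle (measurable_const (a := u)) measurable_id'
    have h2 := γ.measurable_sinAngle measurable_id' (measurable_const (a := u))
    have h3 : Measurable fun v => γ.chord u v :=
      ((γ.continuous_pos.sub continuous_const).norm).measurable
    exact (h1.pow_const a).mul (h2.div h3)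
  · exact mul_nonneg (Real.rpow_nonneg (γ.sinAngle_nonneg _ _) _)
      (div_nonneg (γ.sinAngle_nonneg _ _) (γ.chord_nonneg _ _))

end UnitLoop

theorem abs_sin_natCast_mul_le (k : ℕ) (x : ℝ) : |sin (k * x)| ≤ k * |sin x| := by
  induction k with
  | zero => simp
  | succ k ih =>
    rw [Nat.cast_succ, add_mul, one_mul, sin_add, add_mul, one_mul]
    refine (abs_add_le _ _).trans (add_le_add ?_ ?_)
    · rw [abs_mul]
      exact (mul_le_of_le_one_right (abs_nonneg _) (abs_cos_le_one _)).trans ih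
    · rw [abs_mul]
      exact mul_le_of_le_one_left (abs_nonneg _) (abs_cos_le_one _)

theorem abs_sin_intCast_mul_le (k : ℤ) (x : ℝ) : |sin (k * x)| ≤ |(k : ℝ)| * |sin x| := by
  have h : |sin (k * x)| = |sin ((k.natAbs : ℝ) * x)| := by
    rcases Int.natAbs_eq k with h | h
    · rw [h]; simp
    · rw [h]; simp
  rw [h, ← Int.cast_abs, Int.abs_eq_natAbs, Int.cast_natCast]
  exact abs_sin_natCast_mul_le _ _

theorem fourierCoeffOn_zero_one (f : ℝ → ℂ) (k : ℤ) :
    fourierCoeffOn zero_lt_one f k =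
      ∫ x in (0 : ℝ)..1, Complex.exp (-(2 * π * k) * Complex.I * x) * f x := by
  rw [fourierCoeffOn_eq_integral]
  simp only [sub_zero, div_one, one_smul, fourier_coe_apply, smul_eq_mul]
  refine intervalIntegral.integral_congr fun x _ => ?_
  congr 2
  push_cast
  ring

theorem exp_two_pi_int_add_one (k : ℤ) (x : ℝ) :
    Complex.exp (-(2 * π * k) * Complex.I * (x + 1 : ℝ)) =
      Complex.exp (-(2 * π * k) * Complex.I * x) := by
  rw [Complex.exp_eq_exp_iff_exists_int]
  exact ⟨-k, by push_cast; ring⟩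

theorem fourierCoeffOn_comp_add_sub {f : ℝ → ℂ} (hf : Continuous f) (hp : Function.Periodic f 1)
    (w : ℝ) (k : ℤ) :
    fourierCoeffOn zero_lt_one (fun x => f (x + w) - f x) k =
      (Complex.exp (Complex.I * (2 * π * k * w : ℝ)) - 1) * fourierCoeffOn zero_lt_one f k := by
  have hE : Continuous fun x : ℝ => Complex.exp (-(2 * π * k) * Complex.I * x) := by fun_prop
  have h1 : ∫ x in (0 : ℝ)..1, Complex.exp (-(2 * π * k) * Complex.I * x) * f (x + w) =
      Complex.exp (Complex.I * (2 * π * k * w : ℝ)) *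
        ∫ x in (0 : ℝ)..1, Complex.exp (-(2 * π * k) * Complex.I * x) * f x := by
    have hper : Function.Periodic
        (fun x : ℝ => Complex.exp (-(2 * π * k) * Complex.I * x) * f x) 1 := fun x => by
      simp only [hp x, exp_two_pi_int_add_one]
    have h2 := hper.intervalIntegral_add_eq 0 w
    rw [zero_add] at h2
    rw [h2, ← intervalIntegral.integral_const_mul]
    have h3 := intervalIntegral.integral_comp_add_right (a := 0) (b := 1)
      (fun x : ℝ => Complex.exp (Complex.I * (2 * π * k * w : ℝ)) *
        (Complex.exp (-(2 * π * k) * Complex.I * x) * f x)) w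
    rw [zero_add, add_comm 1 w] at h3
    rw [← h3]
    refine intervalIntegral.integral_congr fun x _ => ?_
    rw [← mul_assoc, ← Complex.exp_add]
    congr 2
    push_cast
    ring
  rw [fourierCoeffOn_zero_one, fourierCoeffOn_zero_one, sub_mul, one_mul, ← h1,
    ← intervalIntegral.integral_sub]
  · refine intervalIntegral.integral_congr fun x _ => ?_
    simp only [mul_sub]
  · exact (hE.mul (hf.comp (continuous_id.add continuous_const))).intervalIntegrable _ _
  · exact (hE.mul hf).intervalIntegrable _ _

theorem fourierCoeffOn_of_ae_hasDerivAt {f f' : ℝ → ℂ} {K : NNReal} (hf : LipschitzWith K f)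
    (hp : Function.Periodic f 1) (hm : Measurable f') (hC : ∀ x, ‖f' x‖ ≤ 1)
    (hd : ∀ᵐ x, HasDerivAt f (f' x) x) (k : ℤ) :
    fourierCoeffOn zero_lt_one f' k = 2 * π * k * Complex.I * fourierCoeffOn zero_lt_one f k := by
  obtain ⟨b, hb⟩ : ∃ b : ℂ, b = -(2 * π * k) * Complex.I := ⟨_, rfl⟩
  have hE : ContDiff ℝ 1 fun x : ℝ => Complex.exp (b * x) :=
    (contDiff_const.mul Complex.ofRealCLM.contDiff).cexp
  have hEd : ∀ x : ℝ, HasDerivAt (fun x : ℝ => Complex.exp (b * x)) (Complex.exp (b * x) * b) x := by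
    intro x
    have h1 : HasDerivAt (fun x : ℝ => b * (x : ℂ)) b x := by
      simpa using (Complex.ofRealCLM.hasDerivAt (x := x)).const_mul b
    exact h1.cexp
  have hint : IntervalIntegrable f' volume 0 1 :=
    (intervalIntegrable_const (c := (1 : ℝ))).mono_fun hm.aestronglyMeasurable
      (Filter.Eventually.of_forall fun x => by simpa using hC x)
  have hnorm : ∀ x : ℝ, ‖Complex.exp (b * x)‖ = 1 := fun x => by
    rw [hb, show -(2 * π * k) * Complex.I * (x : ℂ) = ((-(2 * π * k) * x : ℝ) : ℂ) * Complex.I by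
      push_cast; ring]
    exact Complex.norm_exp_ofReal_mul_I _
  have hEac : AbsolutelyContinuousOnInterval (fun x : ℝ => Complex.exp (b * x)) 0 1 :=
    hE.contDiffOn.absolutelyContinuousOnInterval
  have hfac : AbsolutelyContinuousOnInterval f 0 1 :=
    (hf.lipschitzOnWith (s := uIcc 0 1)).absolutelyContinuousOnInterval
  have hac : AbsolutelyContinuousOnInterval (fun x => Complex.exp (b * x) * f x) 0 1 :=
    hEac.smul hfac
  obtain ⟨M, hM⟩ : ∃ M, ∀ x, ‖f x‖ ≤ M := by
    obtain ⟨M, hM⟩ := isCompact_Icc.exists_bound_of_continuousOn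
      (hf.continuous.continuousOn (s := Icc (0 : ℝ) 1))
    refine ⟨M, fun x => ?_⟩
    obtain ⟨y, hy, hxy⟩ := hp.exists_mem_Ico₀ zero_lt_one x
    rw [hxy]
    exact hM y ⟨hy.1, hy.2.le⟩
  have hI1 : IntervalIntegrable (fun x => Complex.exp (b * x) * f' x) volume 0 1 :=
    hint.continuousOn_mul hE.continuous.continuousOn
  have hI2 : IntervalIntegrable (fun x => b * (Complex.exp (b * x) * f x)) volume 0 1 :=
    (continuous_const.mul (hE.continuous.mul hf.continuous)).intervalIntegrable _ _
  have hper : Complex.exp (b * (1 : ℝ)) * f 1 = Complex.exp (b * (0 : ℝ)) * f 0 := by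
    have h1 := hp 0
    have h2 := exp_two_pi_int_add_one k 0
    rw [zero_add] at h1 h2
    rw [h1, hb, h2]
  have hftc := integral_eq_sub_of_ae_hasDerivAt (C := 1 + ‖b‖ * M)
    (f := fun x => Complex.exp (b * x) * f x)
    (f' := fun x => Complex.exp (b * x) * f' x + b * (Complex.exp (b * x) * f x)) hac
    (hI1.add hI2) (fun x => ?_) ?_
  · rw [intervalIntegral.integral_add hI1 hI2, intervalIntegral.integral_const_mul] at hftc
    rw [hper, sub_self] at hftc
    rw [fourierCoeffOn_zero_one, fourierCoeffOn_zero_one, ← hb, eq_neg_of_add_eq_zero_left hftc,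
      ← neg_mul, hb]
    ring
  · refine (norm_add_le _ _).trans (add_le_add ?_ ?_)
    · rw [norm_mul, hnorm, one_mul]; exact hC x
    · rw [norm_mul, norm_mul, hnorm, one_mul]
      exact mul_le_mul_of_nonneg_left (hM x) (norm_nonneg _)
  · filter_upwards [hd] with x hx _
    refine ((hEd x).mul hx).congr_deriv ?_
    ring

theorem memLp_of_norm_le {f : ℝ → ℂ} {C : ℝ} (hf : Measurable f) (hC : ∀ x, ‖f x‖ ≤ C) :
    MemLp f 2 (volume.restrict (Ioc 0 1)) :=
  MemLp.of_bound hf.aestronglyMeasurable C (Filter.Eventually.of_forall hC)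

/-- Wirtinger's inequality for difference quotients. -/
theorem integral_norm_comp_add_sub_sq_le {f f' : ℝ → ℂ} {K : NNReal} (hf : LipschitzWith K f)
    (hp : Function.Periodic f 1) (hm : Measurable f') (hC : ∀ x, ‖f' x‖ ≤ 1)
    (hd : ∀ᵐ x, HasDerivAt f (f' x) x) (w : ℝ) :
    ∫ x in (0 : ℝ)..1, ‖f (x + w) - f x‖ ^ 2 ≤
      (sin (π * w) / π) ^ 2 * ∫ x in (0 : ℝ)..1, ‖f' x‖ ^ 2 := by
  have h1 := hasSum_sq_fourierCoeffOn zero_lt_one (memLp_of_norm_le (f := fun x => f (x + w) - f x)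
    (C := K * |w|) ((hf.continuous.comp (continuous_id.add continuous_const)).sub
      hf.continuous).measurable fun x => by
        simpa [dist_eq_norm] using hf.dist_le_mul (x + w) x)
  have h2 := (hasSum_sq_fourierCoeffOn zero_lt_one (memLp_of_norm_le hm hC)).mul_left
    ((sin (π * w) / π) ^ 2)
  simp only [sub_zero, inv_one, one_smul] at h1 h2
  refine hasSum_le (fun k => ?_) h1 h2
  rw [fourierCoeffOn_comp_add_sub hf.continuous hp, fourierCoeffOn_of_ae_hasDerivAt hf hp hm hC hd,
    norm_mul, norm_mul, mul_pow, mul_pow, ← mul_assoc]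
  refine mul_le_mul_of_nonneg_right ?_ (sq_nonneg _)
  rw [← mul_pow]
  refine pow_le_pow_left₀ (norm_nonneg _) ?_ 2 |>.trans (le_of_eq (?_ : (2 * (|(k : ℝ)| * |sin (π * w)|)) ^ 2 = _))
  · rw [Complex.norm_exp_I_mul_ofReal_sub_one, norm_mul, Real.norm_two, Real.norm_eq_abs,
      show 2 * π * k * w / 2 = k * (π * w) by ring]
    exact mul_le_mul_of_nonneg_left (abs_sin_intCast_mul_le _ _) zero_le_two
  · have : ‖(2 * π * k * Complex.I : ℂ)‖ = 2 * π * |(k : ℝ)| := by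
      simp [abs_of_pos pi_pos]
    rw [this]
    field_simp
    rw [sq_abs, sq_abs]

theorem setLIntegral_Ioc_eq_of_periodic {f : ℝ → ℝ≥0∞} (hf : Function.Periodic f 1) (s t : ℝ) :
    ∫⁻ x in Ioc s (s + 1), f x = ∫⁻ x in Ioc t (t + 1), f x :=
  (isAddFundamentalDomain_Ioc zero_lt_one s).setLIntegral_eq
    (isAddFundamentalDomain_Ioc zero_lt_one t) f hf.map_vadd_zmultiples

theorem setLIntegral_Ioc_comp_add {f : ℝ → ℝ≥0∞} (hf : Function.Periodic f 1) (s : ℝ) :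
    ∫⁻ x in Ioc (0 : ℝ) 1, f (s + x) = ∫⁻ x in Ioc (0 : ℝ) 1, f x := by
  have h1 := (measurePreserving_add_left volume s).setLIntegral_comp_preimage_emb
    (measurableEmbedding_addLeft s) f (Ioc s (s + 1))
  have h2 : (fun x => s + x) ⁻¹' Ioc s (s + 1) = Ioc (0 : ℝ) 1 := by
    ext x; simp
  rw [h2] at h1
  rw [h1, setLIntegral_Ioc_eq_of_periodic hf s 0, zero_add]

/-- Integrating a function of two points on a circle by means of their difference. -/
theorem lintegral_lintegral_Ioc_eq {K : ℝ → ℝ → ℝ≥0∞} (hK : Measurable (Function.uncurry K))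
    (hp : ∀ u, Function.Periodic (K u) 1) :
    ∫⁻ u in Ioc (0 : ℝ) 1, ∫⁻ v in Ioc (0 : ℝ) 1, K u v =
      ∫⁻ w in Ioc (0 : ℝ) 1, ∫⁻ u in Ioc (0 : ℝ) 1, K u (u + w) := by
  rw [lintegral_lintegral_swap (f := fun w u => K u (u + w))]
  · simp only [fun u => setLIntegral_Ioc_comp_add (hp u) u]
  · exact (hK.comp (measurable_snd.prodMk (measurable_snd.add measurable_fst))).aemeasurable

namespace UnitLoop

variable {n : ℕ} (γ : UnitLoop n)

theorem measurable_chord {X : Type*} [MeasurableSpace X] {f g : X → ℝ} (hf : Measurable f)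
    (hg : Measurable g) : Measurable fun x => γ.chord (f x) (g x) :=
  ((γ.continuous_pos.measurable.comp hg).sub (γ.continuous_pos.measurable.comp hf)).norm

theorem chord_add_one (u v : ℝ) : γ.chord u (v + 1) = γ.chord u v := by
  simp only [chord, γ.pos_periodic v]

theorem integral_chord_sq_le (w : ℝ) :
    ∫ u in (0 : ℝ)..1, γ.chord u (u + w) ^ 2 ≤ (sin (π * w) / π) ^ 2 := by
  have hcoord : ∀ i, ∫ x in (0 : ℝ)..1, ‖((γ.pos (x + w) i : ℝ) : ℂ) - (γ.pos x i : ℝ)‖ ^ 2 ≤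
      (sin (π * w) / π) ^ 2 * ∫ x in (0 : ℝ)..1, ‖((γ.vel x i : ℝ) : ℂ)‖ ^ 2 := fun i => by
    have hmeas : Measurable fun x => γ.vel x i :=
      (EuclideanSpace.proj (𝕜 := ℝ) i).continuous.measurable.comp γ.measurable_vel
    refine integral_norm_comp_add_sub_sq_le (f := fun x => ((γ.pos x i : ℝ) : ℂ))
      (f' := fun x => ((γ.vel x i : ℝ) : ℂ)) (K := 1) ?_ (fun x => ?_)
      (Complex.measurable_ofReal.comp hmeas) (fun x => ?_) ?_ w
    · refine LipschitzWith.of_dist_le_mul fun x y => ?_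
      refine le_trans ?_ (γ.lipschitzWith_pos.dist_le_mul x y)
      rw [dist_eq_norm, dist_eq_norm, ← Complex.ofReal_sub, Complex.norm_real]
      exact PiLp.norm_apply_le (γ.pos x - γ.pos y) i
    · simp only [γ.pos_periodic x]
    · rw [Complex.norm_real]
      exact (PiLp.norm_apply_le (γ.vel x) i).trans (γ.norm_vel x).le
    · filter_upwards [γ.ae_hasDerivAt_pos] with x hx
      have := (EuclideanSpace.proj (𝕜 := ℝ) i).hasFDerivAt.comp_hasDerivAt x hx
      exact this.ofReal_comp
  have hi1 : ∀ i, IntervalIntegrable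
      (fun x => ‖((γ.pos (x + w) i : ℝ) : ℂ) - (γ.pos x i : ℝ)‖ ^ 2) volume 0 1 := fun i => by
    have hc : Continuous fun x => γ.pos x i :=
      (EuclideanSpace.proj (𝕜 := ℝ) i).continuous.comp γ.continuous_pos
    have hc' : Continuous fun x => γ.pos (x + w) i := hc.comp (continuous_id.add continuous_const)
    exact (((Complex.continuous_ofReal.comp hc').sub
      (Complex.continuous_ofReal.comp hc)).norm.pow 2).intervalIntegrable _ _
  have hi2 : ∀ i, IntervalIntegrable (fun x => ‖((γ.vel x i : ℝ) : ℂ)‖ ^ 2) volume 0 1 :=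
    fun i => by
    have hmeas : Measurable fun x => γ.vel x i :=
      (EuclideanSpace.proj (𝕜 := ℝ) i).continuous.measurable.comp γ.measurable_vel
    refine (intervalIntegrable_const (c := (1 : ℝ))).mono_fun
      ((Complex.measurable_ofReal.comp hmeas).norm.pow_const 2).aestronglyMeasurable
      (Filter.Eventually.of_forall fun x => ?_)
    have h1 : ‖γ.vel x i‖ ≤ 1 := (PiLp.norm_apply_le (γ.vel x) i).trans (γ.norm_vel x).le
    simpa using h1
  have h1 : ∀ u, γ.chord u (u + w) ^ 2 =
      ∑ i, ‖((γ.pos (u + w) i : ℝ) : ℂ) - (γ.pos u i : ℝ)‖ ^ 2 := fun u => by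
    rw [chord, EuclideanSpace.norm_sq_eq]
    refine Finset.sum_congr rfl fun i _ => ?_
    rw [← Complex.ofReal_sub, Complex.norm_real, PiLp.sub_apply]
  have h2 : ∀ u, ∑ i, ‖((γ.vel u i : ℝ) : ℂ)‖ ^ 2 = 1 := fun u => by
    rw [← one_pow 2, ← γ.norm_vel u, EuclideanSpace.norm_sq_eq]
    simp only [Complex.norm_real]
  calc ∫ u in (0 : ℝ)..1, γ.chord u (u + w) ^ 2 =
        ∑ i, ∫ x in (0 : ℝ)..1, ‖((γ.pos (x + w) i : ℝ) : ℂ) - (γ.pos x i : ℝ)‖ ^ 2 := by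
        simp only [h1]
        exact intervalIntegral.integral_finsetSum fun i _ => hi1 i
    _ ≤ ∑ i, (sin (π * w) / π) ^ 2 * ∫ x in (0 : ℝ)..1, ‖((γ.vel x i : ℝ) : ℂ)‖ ^ 2 :=
        Finset.sum_le_sum fun i _ => hcoord i
    _ = (sin (π * w) / π) ^ 2 := by
        rw [← Finset.mul_sum, ← intervalIntegral.integral_finsetSum fun i _ => hi2 i]
        simp only [h2]
        simp

theorem lintegral_chord_sq_le (w : ℝ) :
    ∫⁻ u in Ioc (0 : ℝ) 1, ENNReal.ofReal (γ.chord u (u + w) ^ 2) ≤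
      ENNReal.ofReal ((sin (π * w) / π) ^ 2) := by
  have hc : Continuous fun u => γ.chord u (u + w) ^ 2 :=
    (γ.continuous_chord.comp (continuous_id.prodMk (continuous_id.add continuous_const))).pow 2
  rw [← ofReal_integral_eq_lintegral_ofReal
    (((intervalIntegrable_iff_integrableOn_Ioc_of_le zero_le_one).1 (hc.intervalIntegrable 0 1)))
    (Filter.Eventually.of_forall fun u => sq_nonneg _), ← intervalIntegral.integral_of_le zero_le_one]
  exact ENNReal.ofReal_le_ofReal (γ.integral_chord_sq_le w)

theorem lintegral_chord_rpow_le {a w : ℝ} (ha : 0 ≤ a) (ha2 : a ≤ 2) (hw : w ∈ Ioo (0 : ℝ) 1) :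
    ∫⁻ u in Ioc (0 : ℝ) 1, ENNReal.ofReal (γ.chord u (u + w) ^ a) ≤
      ENNReal.ofReal ((sin (π * w) / π) ^ a) := by
  set r := sin (π * w) / π with hr
  have hr0 : 0 < r := div_pos (sin_pos_of_pos_of_lt_pi (mul_pos pi_pos hw.1)
    (mul_lt_of_lt_one_right pi_pos hw.2)) pi_pos
  have hA : 0 ≤ r ^ a * (a / 2) / r ^ 2 := by positivity
  have hB : 0 ≤ r ^ a * (1 - a / 2) := mul_nonneg (by positivity) (by linarith)
  have hpt : ∀ x : ℝ, 0 ≤ x → x ^ a ≤ r ^ a * (a / 2) / r ^ 2 * x ^ 2 + r ^ a * (1 - a / 2) := by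
    intro x hx
    have h1 := Real.geom_mean_le_arith_mean2_weighted (w₁ := a / 2) (w₂ := 1 - a / 2)
      (p₁ := (x / r) ^ 2) (p₂ := 1) (by positivity) (by linarith) (by positivity) zero_le_one
      (by ring)
    rw [one_rpow, mul_one, ← Real.rpow_natCast, ← Real.rpow_mul (by positivity),
      show ((2 : ℕ) : ℝ) * (a / 2) = a by push_cast; ring, Real.div_rpow hx hr0.le,
      div_le_iff₀ (by positivity)] at h1
    refine h1.trans (le_of_eq ?_)
    rw [Nat.cast_ofNat, Real.rpow_two, div_pow]
    ring
  calc ∫⁻ u in Ioc (0 : ℝ) 1, ENNReal.ofReal (γ.chord u (u + w) ^ a)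
      ≤ ∫⁻ u in Ioc (0 : ℝ) 1, (ENNReal.ofReal (r ^ a * (a / 2) / r ^ 2) *
          ENNReal.ofReal (γ.chord u (u + w) ^ 2) + ENNReal.ofReal (r ^ a * (1 - a / 2))) := by
        refine lintegral_mono fun u => ?_
        beta_reduce
        rw [← ENNReal.ofReal_mul hA, ← ENNReal.ofReal_add (mul_nonneg hA (sq_nonneg _)) hB]
        exact ENNReal.ofReal_le_ofReal (hpt _ (γ.chord_nonneg _ _))
    _ = ENNReal.ofReal (r ^ a * (a / 2) / r ^ 2) *
          (∫⁻ u in Ioc (0 : ℝ) 1, ENNReal.ofReal (γ.chord u (u + w) ^ 2)) +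
          ENNReal.ofReal (r ^ a * (1 - a / 2)) := by
        rw [lintegral_add_right _ measurable_const, lintegral_const_mul' _ _ ENNReal.ofReal_ne_top]
        simp
    _ ≤ ENNReal.ofReal (r ^ a * (a / 2) / r ^ 2) * ENNReal.ofReal (r ^ 2) +
          ENNReal.ofReal (r ^ a * (1 - a / 2)) := by
        gcongr
        exact γ.lintegral_chord_sq_le w
    _ = ENNReal.ofReal (r ^ a) := by
        rw [← ENNReal.ofReal_mul hA, ← ENNReal.ofReal_add (mul_nonneg hA (sq_nonneg _)) hB]
        congr 1
        field_simp
        ring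

end UnitLoop

theorem lintegral_sin_rpow_half {a : ℝ} (ha : -1 < a) :
    ∫⁻ w in Ioo (0 : ℝ) (1 / 2), ENNReal.ofReal (sin (π * w) ^ a) =
      ENNReal.ofReal (ProbabilityTheory.beta ((a + 1) / 2) (1 / 2) / (2 * π)) := by
  have hα : 0 < (a + 1) / 2 := by linarith
  have hB := ProbabilityTheory.beta_pos hα (β := 1 / 2) (by norm_num)
  have hs : ∀ w ∈ Ioo (0 : ℝ) (1 / 2), 0 < sin (π * w) ∧ 0 < cos (π * w) := fun w hw =>
    ⟨sin_pos_of_pos_of_lt_pi (mul_pos pi_pos hw.1) (by nlinarith [pi_pos, hw.2]),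
      cos_pos_of_mem_Ioo ⟨by nlinarith [pi_pos, hw.1], by nlinarith [pi_pos, hw.2]⟩⟩
  have himg : (fun w => sin (π * w) ^ 2) '' Ioo (0 : ℝ) (1 / 2) = Ioo 0 1 := by
    ext x
    constructor
    · rintro ⟨w, hw, rfl⟩
      obtain ⟨h1, h2⟩ := hs w hw
      exact ⟨by positivity, by nlinarith [sin_sq_add_cos_sq (π * w)]⟩
    · intro hx
      have h1 : 0 < √x := Real.sqrt_pos.2 hx.1
      have h2 : √x < 1 := (Real.sqrt_lt' zero_lt_one).2 (by simpa using hx.2)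
      refine ⟨arcsin (√x) / π, ⟨div_pos (arcsin_pos.2 h1) pi_pos, ?_⟩, ?_⟩
      · rw [div_lt_iff₀ pi_pos]
        linarith [arcsin_lt_pi_div_two.2 h2]
      · simp only
        rw [mul_div_cancel₀ _ pi_ne_zero, sin_arcsin (by linarith) h2.le, Real.sq_sqrt hx.1.le]
  have hinj : InjOn (fun w => sin (π * w) ^ 2) (Ioo (0 : ℝ) (1 / 2)) := by
    intro x hx y hy hxy
    have h1 := (pow_left_inj₀ (hs x hx).1.le (hs y hy).1.le two_ne_zero).1 hxy
    have h2 := injOn_sin ⟨by nlinarith [pi_pos, hx.1], by nlinarith [pi_pos, hx.2]⟩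
      ⟨by nlinarith [pi_pos, hy.1], by nlinarith [pi_pos, hy.2]⟩ h1
    exact mul_left_cancel₀ pi_ne_zero h2
  have hder : ∀ w ∈ Ioo (0 : ℝ) (1 / 2), HasDerivWithinAt (fun w => sin (π * w) ^ 2)
      (2 * π * sin (π * w) * cos (π * w)) (Ioo 0 (1 / 2)) w := fun w _ => by
    have h1 : HasDerivAt (fun w => π * w) π w := by
      simpa using (hasDerivAt_id w).const_mul π
    refine ((h1.sin.pow 2).congr_deriv ?_).hasDerivWithinAt
    simp
    ring
  have h1 := ProbabilityTheory.lintegral_betaPDF_eq_one hα (β := 1 / 2) (by norm_num)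
  rw [ProbabilityTheory.lintegral_betaPDF, ← himg,
    lintegral_image_eq_lintegral_abs_deriv_mul measurableSet_Ioo hder hinj] at h1
  have hpt : ∀ w ∈ Ioo (0 : ℝ) (1 / 2), ENNReal.ofReal |2 * π * sin (π * w) * cos (π * w)| *
      ENNReal.ofReal (1 / ProbabilityTheory.beta ((a + 1) / 2) (1 / 2) *
        (sin (π * w) ^ 2) ^ ((a + 1) / 2 - 1) * (1 - sin (π * w) ^ 2) ^ ((1 : ℝ) / 2 - 1)) =
      ENNReal.ofReal (2 * π / ProbabilityTheory.beta ((a + 1) / 2) (1 / 2)) *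
        ENNReal.ofReal (sin (π * w) ^ a) := fun w hw => by
    obtain ⟨h1, h2⟩ := hs w hw
    rw [← ENNReal.ofReal_mul (abs_nonneg _), ← ENNReal.ofReal_mul (by positivity),
      abs_of_pos (by positivity), ← cos_sq', ← Real.rpow_natCast, ← Real.rpow_natCast,
      ← Real.rpow_mul h1.le, ← Real.rpow_mul h2.le]
    congr 1
    rw [show ((2 : ℕ) : ℝ) * ((a + 1) / 2 - 1) = a - 1 by push_cast; ring,
      show ((2 : ℕ) : ℝ) * (1 / 2 - 1) = -1 by push_cast; ring, Real.rpow_sub_one h1.ne',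
      Real.rpow_neg_one]
    field_simp
  rw [setLIntegral_congr_fun measurableSet_Ioo hpt,
    lintegral_const_mul' _ _ ENNReal.ofReal_ne_top] at h1
  have hc : 0 < 2 * π / ProbabilityTheory.beta ((a + 1) / 2) (1 / 2) := by positivity
  rw [ENNReal.eq_inv_of_mul_eq_one_left ((mul_comm _ _).trans h1), ← ENNReal.ofReal_inv_of_pos hc,
    inv_div]

theorem lintegral_sin_rpow {a : ℝ} (ha : -1 < a) :
    ∫⁻ w in Ioc (0 : ℝ) 1, ENNReal.ofReal (sin (π * w) ^ a) =
      ENNReal.ofReal (Gamma ((a + 1) / 2) / (√π * Gamma ((a + 2) / 2))) := by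
  have hα : 0 < (a + 1) / 2 := by linarith
  have hB := ProbabilityTheory.beta_pos hα (β := 1 / 2) (by norm_num)
  have hrefl : ∫⁻ w in Ioo (1 / 2 : ℝ) 1, ENNReal.ofReal (sin (π * w) ^ a) =
      ∫⁻ w in Ioo (0 : ℝ) (1 / 2), ENNReal.ofReal (sin (π * w) ^ a) := by
    have h1 := (Measure.measurePreserving_sub_left volume (1 : ℝ)).setLIntegral_comp_preimage_emb
      (Homeomorph.subLeft (1 : ℝ)).measurableEmbedding
      (fun w => ENNReal.ofReal (sin (π * w) ^ a)) (Ioo (0 : ℝ) (1 / 2))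
    have h2 : (fun x : ℝ => 1 - x) ⁻¹' Ioo (0 : ℝ) (1 / 2) = Ioo (1 / 2) 1 := by
      ext x
      simp only [mem_preimage, mem_Ioo]
      constructor <;> rintro ⟨h1, h2⟩ <;> constructor <;> linarith
    rw [h2] at h1
    rw [← h1]
    refine lintegral_congr fun w => ?_
    rw [mul_sub, mul_one, sin_pi_sub]
  have hsplit : Ioc (0 : ℝ) 1 = Ioc 0 (1 / 2) ∪ Ioc (1 / 2) 1 :=
    (Ioc_union_Ioc_eq_Ioc (by norm_num) (by norm_num)).symm
  rw [hsplit, lintegral_union measurableSet_Ioc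
    (disjoint_left.2 fun x hx hy => absurd hx.2 (not_le.2 hy.1)),
    setLIntegral_congr Ioo_ae_eq_Ioc.symm, setLIntegral_congr (s := Ioc (1 / 2) 1) Ioo_ae_eq_Ioc.symm,
    hrefl, lintegral_sin_rpow_half ha, ← ENNReal.ofReal_add (by positivity) (by positivity)]
  congr 1
  rw [ProbabilityTheory.beta, Gamma_one_half_eq, show (a + 1) / 2 + 1 / 2 = (a + 2) / 2 by ring]
  have h2 : 0 < Gamma ((a + 2) / 2) := Gamma_pos_of_pos (by linarith)
  field_simp
  rw [Real.sq_sqrt pi_pos.le]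
  ring

theorem sin_pi_mul_nonneg {w : ℝ} (hw : w ∈ Ioc (0 : ℝ) 1) : 0 ≤ sin (π * w) :=
  sin_nonneg_of_nonneg_of_le_pi (mul_nonneg pi_pos.le hw.1.le)
    (mul_le_of_le_one_right pi_pos.le hw.2)

theorem integral_sin_rpow_eq_Gamma {a : ℝ} (ha : -1 < a) :
    ∫ w in (0 : ℝ)..1, sin (π * w) ^ a = Gamma ((a + 1) / 2) / (√π * Gamma ((a + 2) / 2)) := by
  have h2 : 0 < Gamma ((a + 2) / 2) := Gamma_pos_of_pos (by linarith)
  have h1 : 0 < Gamma ((a + 1) / 2) := Gamma_pos_of_pos (by linarith)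
  rw [intervalIntegral.integral_of_le zero_le_one, integral_eq_lintegral_of_nonneg_ae,
    lintegral_sin_rpow ha, ENNReal.toReal_ofReal (by positivity)]
  · filter_upwards [ae_restrict_mem measurableSet_Ioc] with w hw
    exact Real.rpow_nonneg (sin_pi_mul_nonneg hw) _
  · exact (((measurable_sin.comp (measurable_const_mul π)).pow_const a)).aestronglyMeasurable

theorem lintegral_sin_rpow_eq_ofReal {a : ℝ} (ha : -1 < a) :
    ∫⁻ w in Ioc (0 : ℝ) 1, ENNReal.ofReal (sin (π * w) ^ a) =
      ENNReal.ofReal (∫ w in (0 : ℝ)..1, sin (π * w) ^ a) := by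
  rw [lintegral_sin_rpow ha, integral_sin_rpow_eq_Gamma ha]

theorem integral_sin_rpow_nonneg (a : ℝ) : 0 ≤ ∫ w in (0 : ℝ)..1, sin (π * w) ^ a := by
  rw [intervalIntegral.integral_of_le zero_le_one]
  exact setIntegral_nonneg measurableSet_Ioc fun w hw =>
    Real.rpow_nonneg (sin_pi_mul_nonneg hw) _

theorem integral_abs_cos_rpow (a : ℝ) :
    ∫ θ in (-(π / 2))..(π / 2), |cos θ| ^ a = π * ∫ w in (0 : ℝ)..1, sin (π * w) ^ a := by
  have h1 := intervalIntegral.smul_integral_comp_mul_sub (a := 0) (b := 1)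
    (fun θ => |cos θ| ^ a) π (π / 2)
  rw [mul_zero, zero_sub, mul_one, sub_half, smul_eq_mul] at h1
  rw [← h1]
  congr 1
  rw [intervalIntegral.integral_of_le zero_le_one, intervalIntegral.integral_of_le zero_le_one]
  refine setIntegral_congr_fun measurableSet_Ioc fun w hw => ?_
  rw [cos_sub_pi_div_two, abs_of_nonneg (sin_pi_mul_nonneg hw)]

theorem lintegral_linearCombination {X : Type*} [MeasurableSpace X] {μ : Measure X}
    {f g h : X → ℝ≥0∞} (hf : Measurable f) (hg : Measurable g) (x y z : ℝ) :
    ∫⁻ t, (ENNReal.ofReal x * f t + ENNReal.ofReal y * g t + ENNReal.ofReal z * h t) ∂μ =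
      ENNReal.ofReal x * ∫⁻ t, f t ∂μ + ENNReal.ofReal y * ∫⁻ t, g t ∂μ +
        ENNReal.ofReal z * ∫⁻ t, h t ∂μ := by
  rw [lintegral_add_left (f := fun t => ENNReal.ofReal x * f t + ENNReal.ofReal y * g t)
      ((hf.const_mul _).add (hg.const_mul _)),
    lintegral_add_left (hf.const_mul _), lintegral_const_mul' _ _ ENNReal.ofReal_ne_top,
    lintegral_const_mul' _ _ ENNReal.ofReal_ne_top, lintegral_const_mul' _ _ ENNReal.ofReal_ne_top]

theorem rpow_mul_div_le_of_nonneg {p q A B r : ℝ} (hq : 1 ≤ q) (hp : q + 1 ≤ p) (ha : 0 ≤ 2 * q - p)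
    (hA : 0 ≤ A) (hB : 0 ≤ B) (hr : 0 < r) :
    A ^ (2 * q - p) * (B / r) ≤
      π ^ (q + 1 - p) * ((2 * q - p) / q) * (A ^ q * r ^ (q - p)) +
        π ^ (q + 1 - p) * (1 / q) * (B ^ q * r ^ (q - p)) +
        π ^ (2 * q - p + 1) * ((p - q - 1) / q) * r ^ (2 * q - p) := by
  have hq0 : 0 < q := by linarith
  have hπ := pi_pos
  have key := Real.geom_mean_le_arith_mean3_weighted (w₁ := (2 * q - p) / q) (w₂ := 1 / q)
    (w₃ := (p - q - 1) / q) (p₁ := π ^ (-q) * (A ^ q * r ^ (q - p)))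
    (p₂ := π ^ (-q) * (B ^ q * r ^ (q - p))) (p₃ := r ^ (2 * q - p))
    (by positivity) (by positivity) (div_nonneg (by linarith) hq0.le) (by positivity)
    (by positivity) (by positivity) (by field_simp; ring)
  have h1 : ∀ X x : ℝ, 0 ≤ X → (π ^ (-q) * (X ^ q * r ^ (q - p))) ^ (x / q) =
      π ^ (-x) * (X ^ x * r ^ ((q - p) * (x / q))) := fun X x hX => by
    rw [Real.mul_rpow (by positivity) (by positivity), Real.mul_rpow (by positivity) (by positivity),
      ← Real.rpow_mul hπ.le, ← Real.rpow_mul hX, ← Real.rpow_mul hr.le]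
    congr 2
    · field_simp
    · congr 1
      field_simp
  rw [h1 A _ hA, h1 B _ hB, ← Real.rpow_mul hr.le, Real.rpow_one] at key
  have h2 : A ^ (2 * q - p) * (B / r) = π ^ (2 * q - p + 1) *
      (π ^ (-(2 * q - p)) * (A ^ (2 * q - p) * r ^ ((q - p) * ((2 * q - p) / q))) *
      (π ^ (-1 : ℝ) * (B * r ^ ((q - p) * (1 / q)))) * r ^ ((2 * q - p) * ((p - q - 1) / q))) := by
    have h3 : π ^ (2 * q - p + 1) * π ^ (-(2 * q - p)) * π ^ (-1 : ℝ) = 1 := by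
      rw [← Real.rpow_add hπ, ← Real.rpow_add hπ,
        show 2 * q - p + 1 + -(2 * q - p) + -1 = 0 by ring, Real.rpow_zero]
    have h4 : r ^ ((q - p) * ((2 * q - p) / q)) * r ^ ((q - p) * (1 / q)) *
        r ^ ((2 * q - p) * ((p - q - 1) / q)) = r⁻¹ := by
      rw [← Real.rpow_add hr, ← Real.rpow_add hr, ← Real.rpow_neg_one]
      congr 1
      field_simp
      ring
    calc _ = (π ^ (2 * q - p + 1) * π ^ (-(2 * q - p)) * π ^ (-1 : ℝ)) * (A ^ (2 * q - p) * B *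
          (r ^ ((q - p) * ((2 * q - p) / q)) * r ^ ((q - p) * (1 / q)) *
            r ^ ((2 * q - p) * ((p - q - 1) / q)))) := by rw [h3, h4]; ring
      _ = _ := by ring
  have h5 : π ^ (q + 1 - p) = π ^ (2 * q - p + 1) * π ^ (-q) := by
    rw [← Real.rpow_add hπ]; congr 1; ring
  rw [h2, h5]
  refine (mul_le_mul_of_nonneg_left key (by positivity)).trans (le_of_eq (by ring))

namespace UnitLoop

variable {n : ℕ} (γ : UnitLoop n)

theorem sinAngle_add_one_right (u v : ℝ) : γ.sinAngle u (v + 1) = γ.sinAngle u v := by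
  simp only [sinAngle, γ.pos_periodic v]

theorem sinAngle_add_one_left (u v : ℝ) : γ.sinAngle (u + 1) v = γ.sinAngle u v := by
  simp only [sinAngle, γ.pos_periodic u, γ.vel_periodic u]

theorem chord_add_one_left (u v : ℝ) : γ.chord (u + 1) v = γ.chord u v := by
  simp only [chord, γ.pos_periodic u]

/-- The integrand of the tangent-point energy of an arc length parametrized curve. -/
def energyDensity (p q u v : ℝ) : ℝ≥0∞ :=
  ENNReal.ofReal (γ.sinAngle u v ^ q * γ.chord u v ^ (q - p))

/-- The tangent-point energy of an arc length parametrized curve. -/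
def energy (p q : ℝ) : ℝ≥0∞ :=
  ∫⁻ u in Ioc (0 : ℝ) 1, ∫⁻ v in Ioc (0 : ℝ) 1, γ.energyDensity p q u v

theorem measurable_energyDensity {X : Type*} [MeasurableSpace X] (p q : ℝ) {f g : X → ℝ}
    (hf : Measurable f) (hg : Measurable g) :
    Measurable fun x => γ.energyDensity p q (f x) (g x) :=
  (((γ.measurable_sinAngle hf hg).pow_const q).mul
    ((γ.measurable_chord hf hg).pow_const (q - p))).ennreal_ofReal

theorem energy_swap (p q : ℝ) :
    ∫⁻ u in Ioc (0 : ℝ) 1, ∫⁻ v in Ioc (0 : ℝ) 1, γ.energyDensity p q v u = γ.energy p q :=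
  lintegral_lintegral_swap (f := fun u v => γ.energyDensity p q v u)
    (γ.measurable_energyDensity p q measurable_snd measurable_fst).aemeasurable

theorem lintegral_lintegral_chord_rpow_le {a : ℝ} (ha : 0 ≤ a) (ha2 : a ≤ 2) :
    ∫⁻ u in Ioc (0 : ℝ) 1, ∫⁻ v in Ioc (0 : ℝ) 1, ENNReal.ofReal (γ.chord u v ^ a) ≤
      ENNReal.ofReal (π ^ (-a) * ∫ w in (0 : ℝ)..1, sin (π * w) ^ a) := by
  rw [lintegral_lintegral_Ioc_eq (K := fun u v => ENNReal.ofReal (γ.chord u v ^ a))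
    (((γ.measurable_chord measurable_fst measurable_snd).pow_const a).ennreal_ofReal)
    fun u v => by simp only [chord_add_one], ENNReal.ofReal_mul (by positivity),
    ← lintegral_sin_rpow_eq_ofReal (by linarith), ← lintegral_const_mul' _ _ ENNReal.ofReal_ne_top,
    setLIntegral_congr Ioo_ae_eq_Ioc.symm, setLIntegral_congr (s := Ioc (0 : ℝ) 1)
      (f := fun w => ENNReal.ofReal (π ^ (-a)) * ENNReal.ofReal (sin (π * w) ^ a))
      Ioo_ae_eq_Ioc.symm]
  refine setLIntegral_mono' measurableSet_Ioo fun w hw => ?_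
  refine (γ.lintegral_chord_rpow_le ha ha2 hw).trans (le_of_eq ?_)
  rw [← ENNReal.ofReal_mul (by positivity), Real.div_rpow (sin_pi_mul_nonneg ⟨hw.1, hw.2.le⟩)
    pi_pos.le, Real.rpow_neg pi_pos.le, div_eq_inv_mul]

theorem le_energy_of_nonneg {p q : ℝ} (hq : 1 ≤ q) (hp : q + 1 ≤ p) (ha : 0 ≤ 2 * q - p)
    (h : 2 * q - p ≤ 2 ∨ p = q + 1) :
    ENNReal.ofReal (π ^ (p - q) * ∫ w in (0 : ℝ)..1, sin (π * w) ^ (2 * q - p)) ≤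
      γ.energy p q := by
  set I := ∫ w in (0 : ℝ)..1, sin (π * w) ^ (2 * q - p) with hI
  have hI0 : 0 ≤ I := integral_sin_rpow_nonneg _
  have hq0 : 0 < q := by linarith
  have hπ := pi_pos
  have hc3 : 0 ≤ (p - q - 1) / q := div_nonneg (by linarith) hq0.le
  have hpt : ∀ᵐ u, ENNReal.ofReal (π * I) ≤
      ENNReal.ofReal (π ^ (q + 1 - p) * ((2 * q - p) / q)) *
        (∫⁻ v in Ioc (0 : ℝ) 1, γ.energyDensity p q u v) +
      ENNReal.ofReal (π ^ (q + 1 - p) * (1 / q)) *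
        (∫⁻ v in Ioc (0 : ℝ) 1, γ.energyDensity p q v u) +
      ENNReal.ofReal (π ^ (2 * q - p + 1) * ((p - q - 1) / q)) *
        ∫⁻ v in Ioc (0 : ℝ) 1, ENNReal.ofReal (γ.chord u v ^ (2 * q - p)) := by
    filter_upwards [γ.ae_hasDerivAt_pos] with u hu
    have h1 := γ.ofReal_integral_cos_rpow_le ha hu
    rw [integral_abs_cos_rpow] at h1
    refine h1.trans ?_
    set f : ℝ → ℝ≥0∞ := fun v => ENNReal.ofReal (π ^ (q + 1 - p) * ((2 * q - p) / q)) *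
        γ.energyDensity p q u v + ENNReal.ofReal (π ^ (q + 1 - p) * (1 / q)) *
        γ.energyDensity p q v u + ENNReal.ofReal (π ^ (2 * q - p + 1) * ((p - q - 1) / q)) *
        ENNReal.ofReal (γ.chord u v ^ (2 * q - p)) with hf
    have hper : Function.Periodic f 1 := fun v => by
      simp only [hf, energyDensity, sinAngle_add_one_right, sinAngle_add_one_left, chord_add_one,
        chord_add_one_left]
    have m1 : Measurable fun v => γ.energyDensity p q u v :=
      γ.measurable_energyDensity p q measurable_const measurable_id'
    have m2 : Measurable fun v => γ.energyDensity p q v u :=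
      γ.measurable_energyDensity p q measurable_id' measurable_const
    calc _ ≤ ∫⁻ v in Ioo u (u + 1), f v := by
          refine setLIntegral_mono' measurableSet_Ioo fun v hv => ?_
          simp only [hf, energyDensity]
          rw [← ENNReal.ofReal_mul (by positivity), ← ENNReal.ofReal_mul (by positivity),
            ← ENNReal.ofReal_mul (by positivity), γ.chord_comm v u]
          have hA := γ.sinAngle_nonneg u v
          have hB := γ.sinAngle_nonneg v u
          have hr := γ.chord_pos hv.1 hv.2
          rw [← ENNReal.ofReal_add (by positivity) (by positivity),
            ← ENNReal.ofReal_add (by positivity) (by positivity)]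
          exact ENNReal.ofReal_le_ofReal (rpow_mul_div_le_of_nonneg hq hp ha hA hB hr)
      _ = ∫⁻ v in Ioc (0 : ℝ) 1, f v := by
          rw [setLIntegral_congr Ioo_ae_eq_Ioc, setLIntegral_Ioc_eq_of_periodic hper u 0, zero_add]
      _ = _ := by
          simp only [hf]
          exact lintegral_linearCombination m1 m2 _ _ _
  have hint := lintegral_mono_ae (ae_restrict_of_ae (s := Ioc (0 : ℝ) 1) hpt)
  have m1 : Measurable fun u => ∫⁻ v in Ioc (0 : ℝ) 1, γ.energyDensity p q u v :=
    (γ.measurable_energyDensity p q measurable_fst measurable_snd).lintegral_prod_right'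
  have m2 : Measurable fun u => ∫⁻ v in Ioc (0 : ℝ) 1, γ.energyDensity p q v u :=
    (γ.measurable_energyDensity p q measurable_snd measurable_fst).lintegral_prod_right'
  rw [lintegral_linearCombination m1 m2, energy_swap, ← energy,
    setLIntegral_const, Real.volume_Ioc, sub_zero, ENNReal.ofReal_one, mul_one] at hint
  have hchord : ENNReal.ofReal (π ^ (2 * q - p + 1) * ((p - q - 1) / q)) *
      (∫⁻ u in Ioc (0 : ℝ) 1, ∫⁻ v in Ioc (0 : ℝ) 1,
        ENNReal.ofReal (γ.chord u v ^ (2 * q - p))) ≤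
      ENNReal.ofReal (π * ((p - q - 1) / q) * I) := by
    rcases h with h | h
    · refine (mul_le_mul_right (γ.lintegral_lintegral_chord_rpow_le ha h) _).trans (le_of_eq ?_)
      rw [← ENNReal.ofReal_mul (by positivity), Real.rpow_add_one hπ.ne', Real.rpow_neg hπ.le]
      congr 1
      field_simp
      rw [hI]
    · simp [h]
  by_cases htop : γ.energy p q = ⊤
  · rw [htop]; exact le_top
  have h1 := hint.trans (add_le_add_right hchord _)
  rw [← ENNReal.ofReal_toReal htop, ← ENNReal.ofReal_mul (by positivity),
    ← ENNReal.ofReal_mul (by positivity), ← ENNReal.ofReal_add (by positivity) (by positivity),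
    ← ENNReal.ofReal_add (by positivity) (by positivity),
    ENNReal.ofReal_le_ofReal_iff (by positivity)] at h1
  rw [ENNReal.ofReal_le_iff_le_toReal htop]
  have hP : 0 < π ^ (p - q) := by positivity
  have h2 : π ^ (q + 1 - p) = π / π ^ (p - q) := by
    rw [eq_div_iff hP.ne', ← Real.rpow_add hπ, show q + 1 - p + (p - q) = 1 by ring,
      Real.rpow_one]
  have hm : 0 < (2 * q - p + 1) / q := div_pos (by linarith) hq0
  have h3 : π * ((2 * q - p + 1) / q) * I ≤
      π * ((2 * q - p + 1) / q) * ((γ.energy p q).toReal / π ^ (p - q)) := by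
    have h4 : (p - q - 1) / q = 1 - (2 * q - p + 1) / q := by field_simp; ring
    rw [h2, h4] at h1
    calc _ ≤ π / π ^ (p - q) * ((2 * q - p) / q) * (γ.energy p q).toReal +
          π / π ^ (p - q) * (1 / q) * (γ.energy p q).toReal := by linarith
      _ = _ := by ring
  have h4 := le_of_mul_le_mul_left h3 (by positivity)
  rw [le_div_iff₀ hP] at h4
  linarith

end UnitLoop

theorem neg_lt_of_arcsin_add_pos {x y : ℝ} (h : 0 < arcsin x + arcsin y) : -x < y := by
  by_contra hc
  have h1 := monotone_arcsin (not_lt.1 hc)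
  rw [arcsin_neg] at h1
  linarith

namespace UnitLoop

variable {n : ℕ} (γ : UnitLoop n)

/-- The symmetrized rate of rotation of the secant direction `u ↦ (u, u + w)`. -/
def turning (w u : ℝ) : ℝ := (γ.sinAngle u (u + w) + γ.sinAngle (u + w) u) / γ.chord u (u + w)

theorem turning_nonneg (w u : ℝ) : 0 ≤ γ.turning w u :=
  div_nonneg (add_nonneg (γ.sinAngle_nonneg _ _) (γ.sinAngle_nonneg _ _)) (γ.chord_nonneg _ _)

theorem measurable_turning (w : ℝ) : Measurable (γ.turning w) := by
  have h1 : Measurable fun u : ℝ => u := measurable_id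
  have h2 : Measurable fun u : ℝ => u + w := h1.add_const w
  have h := ((γ.measurable_sinAngle h1 h2).add (γ.measurable_sinAngle h2 h1)).div
    (γ.measurable_chord h1 h2)
  exact h

theorem pos_add_sub_ne {w : ℝ} (hw : w ∈ Ioo (0 : ℝ) 1) (x : ℝ) :
    γ.pos (x + w) - γ.pos x ≠ 0 :=
  γ.pos_ne (by linarith [hw.1]) (by linarith [hw.2])

theorem intervalIntegrable_turning {w : ℝ} (hw : w ∈ Ioo (0 : ℝ) 1) (s t : ℝ) :
    IntervalIntegrable (γ.turning w) volume s t := by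
  wlog hst : s ≤ t generalizing s t
  · exact (this t s (le_of_not_ge hst)).symm
  refine γ.intervalIntegrable_of_continuous_chord
    (ψ := fun x => γ.sinAngle x (x + w) + γ.sinAngle (x + w) x) (x := fun x => x)
    (y := fun x => x + w) (C := 2) hst continuous_id (continuous_id.add continuous_const)
    ((γ.measurable_sinAngle measurable_id' (measurable_id'.add_const w)).add
      (γ.measurable_sinAngle (measurable_id'.add_const w) measurable_id'))
    (fun z => ?_) fun v _ => norm_pos_iff.2 (γ.pos_add_sub_ne hw v)
  rw [abs_of_nonneg (add_nonneg (γ.sinAngle_nonneg _ _) (γ.sinAngle_nonneg _ _))]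
  linarith [γ.sinAngle_le_one z (z + w), γ.sinAngle_le_one (z + w) z]

theorem inner_pos_of_integral_turning_lt {w s t x : ℝ} (hw : w ∈ Ioo (0 : ℝ) 1) (hsx : s ≤ x)
    (hxt : x ≤ t) (h : ∫ u in s..t, γ.turning w u < π) :
    0 < ⟪‖γ.pos (s + w) - γ.pos s‖⁻¹ • (γ.pos (s + w) - γ.pos s) +
      ‖γ.pos (t + w) - γ.pos t‖⁻¹ • (γ.pos (t + w) - γ.pos t), γ.pos (x + w) - γ.pos x⟫ := by
  have hunit : ∀ y, ‖‖γ.pos (y + w) - γ.pos y‖⁻¹ • (γ.pos (y + w) - γ.pos y)‖ = 1 := fun y =>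
    norm_smul_inv_norm (𝕜 := ℝ) (γ.pos_add_sub_ne hw y)
  have hself : ∀ y, ⟪‖γ.pos (y + w) - γ.pos y‖⁻¹ • (γ.pos (y + w) - γ.pos y),
      γ.pos (y + w) - γ.pos y⟫ / ‖γ.pos (y + w) - γ.pos y‖ = 1 := fun y => by
    have := norm_pos_iff.2 (γ.pos_add_sub_ne hw y)
    rw [real_inner_smul_left, real_inner_self_eq_norm_sq]
    field_simp
  have h1 := γ.abs_arcsin_sub_le (hunit s) hw.1 hw.2 hsx
  have h2 := γ.abs_arcsin_sub_le (hunit t) hw.1 hw.2 hxt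
  rw [hself, arcsin_one] at h1 h2
  have h3 := intervalIntegral.integral_add_adjacent_intervals
    (γ.intervalIntegrable_turning hw s x) (γ.intervalIntegrable_turning hw x t)
  simp only [turning] at h h3
  have h4 := (abs_le.1 h1).1
  have h5 := (abs_le.1 h2).2
  have h6 := neg_lt_of_arcsin_add_pos (x := ⟪‖γ.pos (s + w) - γ.pos s‖⁻¹ •
    (γ.pos (s + w) - γ.pos s), γ.pos (x + w) - γ.pos x⟫ / ‖γ.pos (x + w) - γ.pos x‖)
    (y := ⟪‖γ.pos (t + w) - γ.pos t‖⁻¹ •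
    (γ.pos (t + w) - γ.pos t), γ.pos (x + w) - γ.pos x⟫ / ‖γ.pos (x + w) - γ.pos x‖) (by linarith)
  rw [← neg_div, div_lt_div_iff_of_pos_right (norm_pos_iff.2 (γ.pos_add_sub_ne hw x))] at h6
  rw [inner_add_left]
  linarith

theorem two_pi_le_integral_turning {w : ℝ} (hw : w ∈ Ioo (0 : ℝ) 1) :
    2 * π ≤ ∫ u in (0 : ℝ)..1, γ.turning w u := by
  by_contra! hlt
  set ℓ := ∫ u in (0 : ℝ)..1, γ.turning w u with hℓ
  have hℓ0 : 0 ≤ ℓ := intervalIntegral.integral_nonneg zero_le_one fun u _ => γ.turning_nonneg w u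
  have hcont : Continuous fun t => ∫ u in (0 : ℝ)..t, γ.turning w u :=
    intervalIntegral.continuous_primitive (γ.intervalIntegrable_turning hw) 0
  obtain ⟨m, hm, hm2⟩ := intermediate_value_Icc (zero_le_one (α := ℝ)) hcont.continuousOn
    (show ℓ / 2 ∈ Icc _ _ by
      rw [intervalIntegral.integral_same, ← hℓ]; constructor <;> linarith)
  have hm3 : ∫ u in m..1, γ.turning w u = ℓ / 2 := by
    have := intervalIntegral.integral_add_adjacent_intervals
      (γ.intervalIntegrable_turning hw 0 m) (γ.intervalIntegrable_turning hw m 1)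
    simp only at hm2
    linarith
  set D : ℝ → EuclideanSpace ℝ (Fin n) := fun x => γ.pos (x + w) - γ.pos x with hD
  have hD1 : D 1 = D 0 := by
    simp only [hD]
    rw [show (1 : ℝ) + w = (0 + w) + 1 by ring, γ.pos_periodic, ← γ.pos_periodic 0, zero_add 1]
  set e := ‖D 0‖⁻¹ • D 0 + ‖D m‖⁻¹ • D m with he
  have hpos : ∀ x ∈ Icc (0 : ℝ) 1, 0 < ⟪e, D x⟫ := fun x hx => by
    rcases le_total x m with h | h
    · exact γ.inner_pos_of_integral_turning_lt hw hx.1 h (by simp only at hm2; linarith)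
    · have := γ.inner_pos_of_integral_turning_lt hw h hx.2 (by linarith)
      rw [he, add_comm, ← hD1]
      exact this
  have hDc : Continuous D :=
    (γ.continuous_pos.comp (continuous_id.add continuous_const)).sub γ.continuous_pos
  have h1 : 0 < ∫ x in (0 : ℝ)..1, ⟪e, D x⟫ :=
    intervalIntegral.intervalIntegral_pos_of_pos_on
      ((continuous_const.inner hDc).intervalIntegrable 0 1)
      (fun x hx => hpos x (Ioo_subset_Icc_self hx)) zero_lt_one
  have h2 : ∫ x in (0 : ℝ)..1, D x = 0 := by
    have hi : ∀ s t, IntervalIntegrable γ.pos volume s t := fun s t =>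
      γ.continuous_pos.intervalIntegrable s t
    have h3 := γ.pos_periodic.intervalIntegral_add_eq w 0
    simp only [hD]
    have hc : Continuous fun x => γ.pos (x + w) :=
      γ.continuous_pos.comp (continuous_id.add continuous_const)
    rw [intervalIntegral.integral_sub (hc.intervalIntegrable 0 1) (hi 0 1),
      intervalIntegral.integral_comp_add_right, sub_eq_zero, zero_add, add_comm, h3, zero_add]
  have h4 : ∫ x in (0 : ℝ)..1, ⟪e, D x⟫ = ⟪e, ∫ x in (0 : ℝ)..1, D x⟫ :=
    (innerSL ℝ e).intervalIntegral_comp_comm (hDc.intervalIntegrable 0 1)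
  rw [h4, h2, inner_zero_right] at h1
  exact lt_irrefl _ h1

theorem div_pi_le_of_neg {p q X r r₀ : ℝ} (hq : 1 ≤ q) (ha : 2 * q ≤ p) (hp : p ≤ 4 * q - 2)
    (hX : 0 ≤ X) (hr : 0 < r) (hr₀ : 0 < r₀) :
    X / π ≤ 1 / q * (π ^ (-q) * r₀ ^ (p - 2 * q)) * (X ^ q * r ^ (2 * q - p)) +
      (p - 2 * q) / (2 * q) / r₀ ^ 2 * r ^ 2 + (4 * q - 2 - p) / (2 * q) * 1 := by
  have hq0 : 0 < q := by linarith
  have hπ := pi_pos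
  have key := Real.geom_mean_le_arith_mean3_weighted (w₁ := 1 / q) (w₂ := (p - 2 * q) / (2 * q))
    (w₃ := (4 * q - 2 - p) / (2 * q)) (p₁ := π ^ (-q) * r₀ ^ (p - 2 * q) * (X ^ q * r ^ (2 * q - p)))
    (p₂ := r ^ (2 : ℝ) * r₀ ^ (-2 : ℝ)) (p₃ := 1)
    (by positivity) (div_nonneg (by linarith) (by positivity))
    (div_nonneg (by linarith) (by positivity)) (by positivity)
    (by positivity) (by positivity) (by field_simp; ring)
  rw [Real.one_rpow, mul_one, Real.mul_rpow (by positivity) (by positivity),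
    Real.mul_rpow (by positivity) (by positivity), Real.mul_rpow (by positivity) (by positivity),
    Real.mul_rpow (by positivity) (by positivity), ← Real.rpow_mul hπ.le, ← Real.rpow_mul hX,
    ← Real.rpow_mul hr.le, ← Real.rpow_mul hr₀.le, ← Real.rpow_mul hr₀.le, ← Real.rpow_mul hr.le,
    show -q * (1 / q) = -1 by field_simp, show q * (1 / q) = 1 by field_simp, Real.rpow_one,
    Real.rpow_neg_one] at key
  have h1 : r ^ ((2 * q - p) * (1 / q)) * r ^ (2 * ((p - 2 * q) / (2 * q))) = 1 := by
    rw [← Real.rpow_add hr, show (2 * q - p) * (1 / q) + 2 * ((p - 2 * q) / (2 * q)) = 0 by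
      field_simp; ring, Real.rpow_zero]
  have h2 : r₀ ^ ((p - 2 * q) * (1 / q)) * r₀ ^ (-2 * ((p - 2 * q) / (2 * q))) = 1 := by
    rw [← Real.rpow_add hr₀, show (p - 2 * q) * (1 / q) + -2 * ((p - 2 * q) / (2 * q)) = 0 by
      field_simp; ring, Real.rpow_zero]
  calc X / π = π⁻¹ * X * (r ^ ((2 * q - p) * (1 / q)) * r ^ (2 * ((p - 2 * q) / (2 * q)))) *
        (r₀ ^ ((p - 2 * q) * (1 / q)) * r₀ ^ (-2 * ((p - 2 * q) / (2 * q)))) := by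
        rw [h1, h2]; ring
    _ ≤ _ := by
        refine le_trans (le_of_eq ?_) (key.trans (le_of_eq ?_))
        · ring
        · rw [Real.rpow_neg hr₀.le, Real.rpow_two, Real.rpow_two]
          ring

theorem ofReal_le_lintegral_turning {p q w : ℝ} (hq : 1 ≤ q) (ha : 2 * q ≤ p)
    (hp : p ≤ 4 * q - 2) (hw : w ∈ Ioo (0 : ℝ) 1) :
    ENNReal.ofReal (π ^ (p - q) * sin (π * w) ^ (2 * q - p)) ≤
      ∫⁻ u in Ioc (0 : ℝ) 1,
        ENNReal.ofReal ((γ.turning w u / 2) ^ q * γ.chord u (u + w) ^ (2 * q - p)) := by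
  have hq0 : 0 < q := by linarith
  have hπ := pi_pos
  have hsin : 0 < sin (π * w) := sin_pos_of_pos_of_lt_pi (mul_pos hπ hw.1)
    (mul_lt_of_lt_one_right hπ hw.2)
  set r₀ := sin (π * w) / π with hr₀
  have hr₀p : 0 < r₀ := div_pos hsin hπ
  have hl2 : 0 ≤ (p - 2 * q) / (2 * q) := div_nonneg (by linarith) (by positivity)
  have hl3 : 0 ≤ (4 * q - 2 - p) / (2 * q) := div_nonneg (by linarith) (by positivity)
  have mt : Measurable fun u => γ.turning w u := γ.measurable_turning w
  have mc : Measurable fun u => γ.chord u (u + w) :=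
    γ.measurable_chord measurable_id' (measurable_id'.add_const w)
  set J := ∫⁻ u in Ioc (0 : ℝ) 1,
    ENNReal.ofReal ((γ.turning w u / 2) ^ q * γ.chord u (u + w) ^ (2 * q - p)) with hJ
  have h1 : ENNReal.ofReal 1 ≤ ∫⁻ u in Ioc (0 : ℝ) 1, ENNReal.ofReal (γ.turning w u / 2 / π) := by
    refine le_trans (ENNReal.ofReal_le_ofReal ?_) (ofReal_integral_le_lintegral
      (f := fun u => γ.turning w u / 2 / π) ((mt.div_const 2).div_const π).aestronglyMeasurable
      (Filter.Eventually.of_forall fun u => div_nonneg (div_nonneg (γ.turning_nonneg w u)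
        zero_le_two) hπ.le))
    rw [← intervalIntegral.integral_of_le zero_le_one, intervalIntegral.integral_div,
      intervalIntegral.integral_div, div_div, le_div_iff₀ (by positivity), one_mul]
    exact γ.two_pi_le_integral_turning hw
  have h2 : ∫⁻ u in Ioc (0 : ℝ) 1, ENNReal.ofReal (γ.turning w u / 2 / π) ≤
      ENNReal.ofReal (1 / q * (π ^ (-q) * r₀ ^ (p - 2 * q))) * J +
      ENNReal.ofReal ((p - 2 * q) / (2 * q) / r₀ ^ 2) *
        (∫⁻ u in Ioc (0 : ℝ) 1, ENNReal.ofReal (γ.chord u (u + w) ^ 2)) +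
      ENNReal.ofReal ((4 * q - 2 - p) / (2 * q)) *
        ∫⁻ u in Ioc (0 : ℝ) 1, ENNReal.ofReal 1 := by
    rw [hJ, ← lintegral_linearCombination
      (f := fun u =>
        ENNReal.ofReal ((γ.turning w u / 2) ^ q * γ.chord u (u + w) ^ (2 * q - p)))
      (((mt.div_const 2).pow_const q).mul (mc.pow_const (2 * q - p))).ennreal_ofReal
      (mc.pow_const 2).ennreal_ofReal]
    refine lintegral_mono fun u => ?_
    have hX : 0 ≤ γ.turning w u / 2 := div_nonneg (γ.turning_nonneg w u) zero_le_two
    have hr : 0 < γ.chord u (u + w) := norm_pos_iff.2 (γ.pos_add_sub_ne hw u)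
    beta_reduce
    rw [← ENNReal.ofReal_mul (by positivity), ← ENNReal.ofReal_mul (by positivity),
      ← ENNReal.ofReal_mul (by positivity), ← ENNReal.ofReal_add (by positivity) (by positivity),
      ← ENNReal.ofReal_add (by positivity) (by positivity)]
    exact ENNReal.ofReal_le_ofReal (div_pi_le_of_neg hq ha hp hX hr hr₀p)
  rw [setLIntegral_const, Real.volume_Ioc, sub_zero, ← ENNReal.ofReal_mul zero_le_one, one_mul] at h2
  have h3 := (h1.trans h2).trans (add_le_add_left (add_le_add_right
    (mul_le_mul_right (γ.lintegral_chord_sq_le w) _) _) _)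
  by_cases htop : J = ⊤
  · rw [htop]; exact le_top
  rw [← hr₀, ← ENNReal.ofReal_toReal htop, ← ENNReal.ofReal_mul (by positivity),
    ← ENNReal.ofReal_mul (by positivity), ← ENNReal.ofReal_mul (by positivity),
    ← ENNReal.ofReal_add (by positivity) (by positivity),
    ← ENNReal.ofReal_add (by positivity) (by positivity),
    ENNReal.ofReal_le_ofReal_iff (by positivity), div_mul_cancel₀ _ (by positivity), mul_one] at h3
  rw [ENNReal.ofReal_le_iff_le_toReal htop]
  have h4 : 1 / q * 1 ≤ 1 / q * (π ^ (-q) * r₀ ^ (p - 2 * q) * J.toReal) := by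
    have : (4 * q - 2 - p) / (2 * q) = 1 - 1 / q - (p - 2 * q) / (2 * q) := by field_simp; ring
    rw [this] at h3
    linarith
  have h5 := le_of_mul_le_mul_left h4 (by positivity)
  have h6 : π ^ (p - q) * sin (π * w) ^ (2 * q - p) * (π ^ (-q) * r₀ ^ (p - 2 * q)) = 1 := by
    rw [hr₀, Real.div_rpow hsin.le hπ.le]
    calc _ = π ^ (p - q) * π ^ (-q) / π ^ (p - 2 * q) *
          (sin (π * w) ^ (2 * q - p) * sin (π * w) ^ (p - 2 * q)) := by ring
      _ = 1 := by
          rw [← Real.rpow_add hπ, ← Real.rpow_sub hπ, ← Real.rpow_add hsin,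
            show p - q + -q - (p - 2 * q) = 0 by ring, show 2 * q - p + (p - 2 * q) = 0 by ring,
            Real.rpow_zero, Real.rpow_zero, mul_one]
  calc _ ≤ π ^ (p - q) * sin (π * w) ^ (2 * q - p) *
        (π ^ (-q) * r₀ ^ (p - 2 * q) * J.toReal) := le_mul_of_one_le_right (by positivity) h5
    _ = π ^ (p - q) * sin (π * w) ^ (2 * q - p) * (π ^ (-q) * r₀ ^ (p - 2 * q)) * J.toReal := by
        ring
    _ = J.toReal := by rw [h6, one_mul]

theorem half_add_rpow_le {q x y : ℝ} (hq : 1 ≤ q) (hx : 0 ≤ x) (hy : 0 ≤ y) :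
    ((x + y) / 2) ^ q ≤ 1 / 2 * x ^ q + 1 / 2 * y ^ q := by
  have h := (convexOn_rpow hq).2 (mem_Ici.2 hx) (mem_Ici.2 hy) (show (0 : ℝ) ≤ 1 / 2 by norm_num)
    (show (0 : ℝ) ≤ 1 / 2 by norm_num) (by norm_num)
  simp only [smul_eq_mul] at h
  rwa [show (x + y) / 2 = 1 / 2 * x + 1 / 2 * y by ring]

theorem le_energy_of_nonpos {p q : ℝ} (hq : 1 ≤ q) (ha : 2 * q ≤ p) (ha' : p < 2 * q + 1)
    (hp : p ≤ 4 * q - 2) :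
    ENNReal.ofReal (π ^ (p - q) * ∫ w in (0 : ℝ)..1, sin (π * w) ^ (2 * q - p)) ≤
      γ.energy p q := by
  have hπ := pi_pos
  set K : ℝ → ℝ → ℝ≥0∞ := fun u v => ENNReal.ofReal (1 / 2) * γ.energyDensity p q u v +
    ENNReal.ofReal (1 / 2) * γ.energyDensity p q v u + ENNReal.ofReal 0 * 0 with hK
  have hKm : Measurable (Function.uncurry K) :=
    (((γ.measurable_energyDensity p q measurable_fst measurable_snd).const_mul _).add
      ((γ.measurable_energyDensity p q measurable_snd measurable_fst).const_mul _)).add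
      measurable_const
  have hKp : ∀ u, Function.Periodic (K u) 1 := fun u v => by
    simp only [hK, energyDensity, sinAngle_add_one_right, sinAngle_add_one_left, chord_add_one,
      chord_add_one_left]
  have hKe : ∫⁻ u in Ioc (0 : ℝ) 1, ∫⁻ v in Ioc (0 : ℝ) 1, K u v = γ.energy p q := by
    have h1 : ∀ u, ∫⁻ v in Ioc (0 : ℝ) 1, K u v =
        ENNReal.ofReal (1 / 2) * (∫⁻ v in Ioc (0 : ℝ) 1, γ.energyDensity p q u v) +
        ENNReal.ofReal (1 / 2) * (∫⁻ v in Ioc (0 : ℝ) 1, γ.energyDensity p q v u) +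
        ENNReal.ofReal 0 * ∫⁻ v in Ioc (0 : ℝ) 1, 0 := fun u =>
      lintegral_linearCombination (γ.measurable_energyDensity p q measurable_const measurable_id')
        (γ.measurable_energyDensity p q measurable_id' measurable_const) _ _ _
    have m1 : Measurable fun u => ∫⁻ v in Ioc (0 : ℝ) 1, γ.energyDensity p q u v :=
      (γ.measurable_energyDensity p q measurable_fst measurable_snd).lintegral_prod_right'
    have m2 : Measurable fun u => ∫⁻ v in Ioc (0 : ℝ) 1, γ.energyDensity p q v u :=
      (γ.measurable_energyDensity p q measurable_snd measurable_fst).lintegral_prod_right'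
    simp only [h1]
    rw [lintegral_linearCombination m1 m2, energy_swap, ← energy, ENNReal.ofReal_zero, zero_mul,
      add_zero, ← add_mul, ← ENNReal.ofReal_add (by norm_num) (by norm_num), add_halves,
      ENNReal.ofReal_one, one_mul]
  rw [← hKe, lintegral_lintegral_Ioc_eq hKm hKp, ENNReal.ofReal_mul (by positivity),
    ← lintegral_sin_rpow_eq_ofReal (by linarith), ← lintegral_const_mul' _ _ ENNReal.ofReal_ne_top,
    setLIntegral_congr Ioo_ae_eq_Ioc.symm, setLIntegral_congr (s := Ioc (0 : ℝ) 1)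
      (f := fun w => ∫⁻ u in Ioc (0 : ℝ) 1, K u (u + w)) Ioo_ae_eq_Ioc.symm]
  refine setLIntegral_mono' measurableSet_Ioo fun w hw => ?_
  rw [← ENNReal.ofReal_mul (by positivity)]
  refine (γ.ofReal_le_lintegral_turning hq ha hp hw).trans (lintegral_mono fun u => ?_)
  have hr : 0 < γ.chord u (u + w) := norm_pos_iff.2 (γ.pos_add_sub_ne hw u)
  have hA := γ.sinAngle_nonneg u (u + w)
  have hB := γ.sinAngle_nonneg (u + w) u
  simp only [hK, energyDensity, mul_zero, add_zero]
  rw [← ENNReal.ofReal_mul (by positivity), ← ENNReal.ofReal_mul (by positivity),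
    γ.chord_comm (u + w), ← ENNReal.ofReal_add (by positivity) (by positivity)]
  refine ENNReal.ofReal_le_ofReal ?_
  have h1 : (γ.turning w u / 2) ^ q * γ.chord u (u + w) ^ (2 * q - p) =
      ((γ.sinAngle u (u + w) + γ.sinAngle (u + w) u) / 2) ^ q * γ.chord u (u + w) ^ (q - p) := by
    rw [turning, div_right_comm, Real.div_rpow (by positivity) hr.le, div_mul_eq_mul_div,
      mul_div_assoc, ← Real.rpow_sub hr]
    congr 2
    ring
  rw [h1]
  refine (mul_le_mul_of_nonneg_right (half_add_rpow_le hq hA hB) (by positivity)).trans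
    (le_of_eq (by ring))

end UnitLoop

theorem setLIntegral_ofReal_eq_ofReal_intervalIntegral {ρ : ℝ → ℝ} {s t : ℝ}
    (hi : IntervalIntegrable ρ volume s t) (h0 : ∀ x, 0 ≤ ρ x) (hst : s ≤ t) :
    ∫⁻ x in Ioc s t, ENNReal.ofReal (ρ x) = ENNReal.ofReal (∫ x in s..t, ρ x) := by
  rw [intervalIntegral.integral_of_le hst, ofReal_integral_eq_lintegral_ofReal hi.1
    (Filter.Eventually.of_forall h0)]

theorem exists_orderIso_integral_eq_sub {ρ : ℝ → ℝ} (hi : ∀ s t, IntervalIntegrable ρ volume s t)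
    (hper : Function.Periodic ρ 1) (h0 : ∀ x, 0 ≤ ρ x) (hpos : ∀ᵐ x, ρ x ≠ 0)
    (h1 : ∫ x in (0 : ℝ)..1, ρ x = 1) :
    ∃ σ : ℝ ≃o ℝ, σ 0 = 0 ∧ (∀ s t, ∫ x in s..t, ρ x = σ t - σ s) ∧
      MeasurePreserving σ (volume.withDensity fun x => ENNReal.ofReal (ρ x)) volume := by
  have hsub : ∀ s t, ∫ x in s..t, ρ x = (∫ x in (0 : ℝ)..t, ρ x) - ∫ x in (0 : ℝ)..s, ρ x :=
    fun s t => (intervalIntegral.integral_interval_sub_left (hi 0 t) (hi 0 s)).symm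
  have hmono : StrictMono fun t => ∫ x in (0 : ℝ)..t, ρ x := fun s t hst => by
    rw [← sub_pos, ← hsub, intervalIntegral.integral_pos_iff_support_of_nonneg_ae
      (Filter.Eventually.of_forall h0) (hi s t)]
    refine ⟨hst, ?_⟩
    have h2 : volume (Function.support ρ ∩ Ioc s t) = volume (Ioc s t) :=
      measure_congr (by
        filter_upwards [hpos] with x hx
        exact propext ⟨fun h => h.2, fun h => ⟨hx, h⟩⟩)
    rw [h2, Real.volume_Ioc]
    simpa using hst
  have hcont : Continuous fun t => ∫ x in (0 : ℝ)..t, ρ x :=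
    intervalIntegral.continuous_primitive hi 0
  have hsurj : Function.Surjective fun t => ∫ x in (0 : ℝ)..t, ρ x :=
    hcont.surjective
      (hper.tendsto_atTop_intervalIntegral_of_pos (by rw [h1]; exact zero_lt_one) zero_lt_one)
      (hper.tendsto_atBot_intervalIntegral_of_pos (by rw [h1]; exact zero_lt_one) zero_lt_one)
  refine ⟨hmono.orderIsoOfSurjective _ hsurj, by simp, by simpa using hsub, ?_⟩
  set σ := hmono.orderIsoOfSurjective _ hsurj with hσ
  have hσm : Measurable σ := σ.continuous.measurable
  refine ⟨hσm, (Measure.ext_of_Ioc _ _ fun a b hab => ?_).symm⟩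
  have hpre : σ ⁻¹' Ioc a b = Ioc (σ.symm a) (σ.symm b) := by
    ext x
    simp [OrderIso.le_symm_apply, OrderIso.symm_apply_lt]
  rw [Measure.map_apply hσm measurableSet_Ioc, hpre, withDensity_apply _ measurableSet_Ioc,
    setLIntegral_ofReal_eq_ofReal_intervalIntegral (hi _ _) h0 (σ.symm.monotone hab.le), hsub,
    Real.volume_Ioc]
  congr 1
  exact congrArg₂ (· - ·) (σ.apply_symm_apply b).symm (σ.apply_symm_apply a).symm

theorem projPerp_smul_left {F : Type*} [NormedAddCommGroup F] [InnerProductSpace ℝ F] {c : ℝ}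
    (hc : c ≠ 0) (v x : F) : projPerp (c • v) x = projPerp v x := by
  rcases eq_or_ne v 0 with rfl | hv
  · simp
  have := norm_ne_zero_iff.2 hv
  simp only [projPerp, norm_smul, real_inner_smul_left, smul_smul, mul_pow, Real.norm_eq_abs, sq_abs]
  congr 2
  field_simp

theorem projPerp_smul_right {F : Type*} [NormedAddCommGroup F] [InnerProductSpace ℝ F] (c : ℝ)
    (v x : F) : projPerp v (c • x) = c • projPerp v x := by
  simp only [projPerp, inner_smul_right, smul_sub, smul_smul]
  congr 2
  ring

theorem UnitLoop.norm_projPerp_vel {n : ℕ} (γ : UnitLoop n) (u v : ℝ) :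
    ‖projPerp (γ.vel u) (γ.pos v - γ.pos u)‖ = γ.chord u v * γ.sinAngle u v := by
  rcases eq_or_ne (γ.pos v - γ.pos u) 0 with h | h
  · simp [projPerp, h, UnitLoop.chord]
  have hn : 0 < ‖γ.pos v - γ.pos u‖ := norm_pos_iff.2 h
  have h1 := (sq_le_one_iff_abs_le_one _).2
    (abs_inner_div_norm_le_one (γ.norm_vel u) (γ.pos v - γ.pos u))
  rw [← Real.sqrt_sq (norm_nonneg (projPerp _ _)), UnitLoop.chord, UnitLoop.sinAngle,
    ← Real.sqrt_sq hn.le, ← Real.sqrt_mul (sq_nonneg _), Real.sqrt_sq hn.le, projPerp,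
    norm_sub_sq_real, γ.norm_vel, inner_smul_right, norm_smul, Real.norm_eq_abs, mul_pow, sq_abs,
    real_inner_comm (γ.pos v - γ.pos u), γ.norm_vel]
  congr 1
  field_simp
  ring

theorem ofReal_projPerp_integrand_eq {n : ℕ} (γ : UnitLoop n) {p q L c d u v : ℝ} (hq : 0 < q)
    (hp : q < p) (hL : 0 < L) :
    ENNReal.ofReal (‖L • projPerp (γ.vel u) (γ.pos v - γ.pos u)‖ ^ q /
        ‖L • (γ.pos v - γ.pos u)‖ ^ p * (L * c * (L * d))) =
      ENNReal.ofReal (L ^ (q + 2 - p)) * (γ.energyDensity p q u v * ENNReal.ofReal (c * d)) := by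
  rw [UnitLoop.energyDensity, ← ENNReal.ofReal_mul (mul_nonneg (by
    exact Real.rpow_nonneg (γ.sinAngle_nonneg _ _) _) (Real.rpow_nonneg (γ.chord_nonneg _ _) _)),
    ← ENNReal.ofReal_mul (by positivity), norm_smul, norm_smul, γ.norm_projPerp_vel,
    Real.norm_of_nonneg hL.le, ← UnitLoop.chord]
  congr 1
  have hA := γ.sinAngle_nonneg u v
  rcases (γ.chord_nonneg u v).eq_or_lt with h | h
  · rw [← h]
    simp [Real.zero_rpow hq.ne', Real.zero_rpow (sub_neg.2 hp).ne]
  · rw [Real.mul_rpow hL.le (by positivity), Real.mul_rpow h.le hA, Real.mul_rpow hL.le h.le,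
      Real.rpow_sub h, show q + 2 - p = q - p + 2 by ring, Real.rpow_add hL, Real.rpow_sub hL,
      Real.rpow_two]
    ring

namespace ClosedCurve

variable {n : ℕ} (γ : ClosedCurve n)

theorem intervalIntegrable_deriv' (s t : ℝ) : IntervalIntegrable γ.deriv' volume s t :=
  γ.deriv'_periodic.intervalIntegrable₀ one_ne_zero
    ((intervalIntegrable_iff_integrableOn_Icc_of_le zero_le_one).2 γ.integrableOn) s t

theorem integral_deriv'_eq_sub (s t : ℝ) : ∫ x in s..t, γ.deriv' x = γ.toFun t - γ.toFun s := by
  rw [γ.eq_integral t, γ.eq_integral s, add_sub_add_left_eq_sub,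
    intervalIntegral.integral_interval_sub_left (γ.intervalIntegrable_deriv' 0 t)
      (γ.intervalIntegrable_deriv' 0 s)]

theorem locallyIntegrable_of_intervalIntegrable {F : Type*} [NormedAddCommGroup F] {f : ℝ → F}
    (hf : ∀ s t, IntervalIntegrable f volume s t) : LocallyIntegrable f volume := fun x =>
  ⟨Ioo (x - 1) (x + 1), Ioo_mem_nhds (by linarith) (by linarith),
    ((intervalIntegrable_iff_integrableOn_Ioc_of_le (by linarith)).1
      (hf (x - 1) (x + 1))).mono_set Ioo_subset_Ioc_self⟩

theorem ae_hasDerivAt_of_integral_eq_sub {F : Type*} [NormedAddCommGroup F] [NormedSpace ℝ F]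
    [CompleteSpace F] {f f' : ℝ → F} (hf' : ∀ s t, IntervalIntegrable f' volume s t)
    (h : ∀ s t, ∫ x in s..t, f' x = f t - f s) : ∀ᵐ t, HasDerivAt f (f' t) t := by
  filter_upwards [LocallyIntegrable.ae_hasDerivAt_integral
    (locallyIntegrable_of_intervalIntegrable hf')] with t ht
  have h1 : f = fun x => (∫ s in (0 : ℝ)..x, f' s) + f 0 := by
    funext x; rw [h, sub_add_cancel]
  rw [h1]
  exact (ht 0).add_const _

variable {L : ℝ}

theorem exists_orderIso_speed (hL : 0 < L) (hreg : γ.IsRegular) (hlen : γ.length = L) :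
    ∃ σ : ℝ ≃o ℝ, (∀ (k : ℤ) t, σ (t + k) = σ t + k) ∧ σ 0 = 0 ∧
      (∀ s t, ∫ x in s..t, ‖γ.deriv' x‖ / L = σ t - σ s) ∧
      MeasurePreserving σ (volume.withDensity fun x => ENNReal.ofReal (‖γ.deriv' x‖ / L))
        volume := by
  have hρi : ∀ s t, IntervalIntegrable (fun t => ‖γ.deriv' t‖ / L) volume s t := fun s t =>
    (γ.intervalIntegrable_deriv' s t).norm.div_const L
  have hρp : Function.Periodic (fun t => ‖γ.deriv' t‖ / L) 1 := fun t => by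
    simp only [γ.deriv'_periodic t]
  have hρ1 : ∫ t in (0 : ℝ)..1, ‖γ.deriv' t‖ / L = 1 := by
    rw [intervalIntegral.integral_div, ← ClosedCurve.length, hlen, div_self hL.ne']
  obtain ⟨σ, hσ0, hσi, hσm⟩ := exists_orderIso_integral_eq_sub hρi hρp
    (fun t => by positivity) (by
      filter_upwards [hreg] with t ht
      exact div_ne_zero (norm_ne_zero_iff.2 ht) hL.ne') hρ1
  have hσp : ∀ t, σ (t + 1) = σ t + 1 := fun t => by
    have h1 := hρp.intervalIntegral_add_eq t 0
    rw [zero_add, hρ1, hσi] at h1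
    linarith
  refine ⟨σ, fun k => ?_, hσ0, hσi, hσm⟩
  induction k using Int.induction_on with
  | zero => simp
  | succ k ih => intro t; push_cast at ih ⊢; rw [← add_assoc, hσp, ih, add_assoc]
  | pred k ih =>
    intro t
    have h1 := hσp (t + ((-(k : ℤ) - 1 : ℤ) : ℝ))
    have h2 := ih t
    push_cast at h1 h2 ⊢
    rw [show t + (-(k : ℝ) - 1) + 1 = t + -(k : ℝ) by ring, h2] at h1
    linarith

theorem exists_unitLoop_pos_eq (hL : 0 < L) (hinj : γ.IsInj) (hreg : γ.IsRegular) {σ : ℝ ≃o ℝ}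
    (hσz : ∀ (k : ℤ) t, σ (t + k) = σ t + k)
    (hσi : ∀ s t, ∫ x in s..t, ‖γ.deriv' x‖ / L = σ t - σ s)
    (hσm : MeasurePreserving σ (volume.withDensity fun x => ENNReal.ofReal (‖γ.deriv' x‖ / L))
      volume) :
    ∃ Γ : UnitLoop n, (∀ s, Γ.pos s = L⁻¹ • γ.toFun (σ.symm s)) ∧
      ∀ᵐ t, 0 < ‖γ.deriv' t‖ ∧ γ.deriv' t = ‖γ.deriv' t‖ • Γ.vel (σ t) := by
  have hρi : ∀ s t, IntervalIntegrable (fun t => ‖γ.deriv' t‖ / L) volume s t := fun s t =>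
    (γ.intervalIntegrable_deriv' s t).norm.div_const L
  have hτp : ∀ s, σ.symm (s + 1) = σ.symm s + 1 := fun s => by
    have h1 := hσz 1 (σ.symm s)
    rw [Int.cast_one, σ.apply_symm_apply] at h1
    rw [σ.symm_apply_eq, h1]
  set P : ℝ → EuclideanSpace ℝ (Fin n) := fun s => L⁻¹ • γ.toFun (σ.symm s) with hP
  have hPp : Function.Periodic P 1 := fun s => by
    simp only [hP]; rw [hτp, γ.periodic]
  have hPlip : LipschitzWith 1 P := by
    refine LipschitzWith.of_dist_le_mul fun s t => ?_
    rw [NNReal.coe_one, one_mul]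
    wlog hst : t ≤ s generalizing s t
    · rw [dist_comm, dist_comm s]; exact this t s (le_of_not_ge hst)
    have h1 : σ.symm t ≤ σ.symm s := σ.symm.monotone hst
    rw [dist_eq_norm, Real.dist_eq, abs_of_nonneg (sub_nonneg.2 hst)]
    simp only [hP]
    rw [← smul_sub, ← γ.integral_deriv'_eq_sub, norm_smul, Real.norm_of_nonneg (by positivity)]
    have h2 := hσi (σ.symm t) (σ.symm s)
    rw [σ.apply_symm_apply, σ.apply_symm_apply, intervalIntegral.integral_div] at h2
    rw [← h2, div_eq_inv_mul]
    exact mul_le_mul_of_nonneg_left (intervalIntegral.norm_integral_le_integral_norm h1)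
      (by positivity)
  have hgood : ∀ᵐ t, 0 < ‖γ.deriv' t‖ ∧
      HasDerivAt P (‖γ.deriv' t‖⁻¹ • γ.deriv' t) (σ t) := by
    filter_upwards [hreg, ae_hasDerivAt_of_integral_eq_sub γ.intervalIntegrable_deriv'
      γ.integral_deriv'_eq_sub, ae_hasDerivAt_of_integral_eq_sub hρi hσi] with t h1 h2 h3
    have h4 : 0 < ‖γ.deriv' t‖ := norm_pos_iff.2 h1
    refine ⟨h4, ?_⟩
    have h5 : HasDerivAt σ.symm (‖γ.deriv' t‖ / L)⁻¹ (σ t) := by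
      refine HasDerivAt.of_local_left_inverse (f := σ) σ.symm.continuous.continuousAt ?_
        (div_pos h4 hL).ne' (Filter.Eventually.of_forall fun y => σ.apply_symm_apply y)
      rwa [σ.symm_apply_apply]
    have h6 := (HasDerivAt.scomp (σ t) (h := σ.symm) (g₁ := γ.toFun)
      (by rwa [σ.symm_apply_apply]) h5).const_smul L⁻¹
    refine h6.congr_deriv ?_
    rw [smul_smul]
    congr 1
    field_simp
  have hae : ∀ {p : ℝ → Prop}, (∀ᵐ t, p t) → ∀ᵐ s, p (σ.symm s) := fun {p} hp => by
    have h1 : ∀ᵐ t ∂volume.withDensity fun x => ENNReal.ofReal (‖γ.deriv' x‖ / L), p t :=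
      (withDensity_absolutelyContinuous volume _).ae_le hp
    rw [← hσm.map_eq]
    refine (σ.toHomeomorph.measurableEmbedding.ae_map_iff (p := fun s => p (σ.symm s))).2 ?_
    filter_upwards [h1] with t ht
    change p (σ.symm (σ t))
    rwa [σ.symm_apply_apply]
  have hderiv : ∀ᵐ s, ‖deriv P s‖ = 1 ∧ HasDerivAt P (deriv P s) s := by
    filter_upwards [hae hgood] with s hs
    rw [σ.apply_symm_apply] at hs
    rw [hs.2.deriv]
    refine ⟨?_, hs.2⟩
    rw [norm_smul, norm_inv, norm_norm, inv_mul_cancel₀ hs.1.ne']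
  obtain ⟨e, he⟩ : ∃ e : EuclideanSpace ℝ (Fin n), ‖e‖ = 1 := by
    obtain ⟨s, hs⟩ := hderiv.exists
    exact ⟨_, hs.1⟩
  classical
  set V : ℝ → EuclideanSpace ℝ (Fin n) := fun s => if ‖deriv P s‖ = 1 then deriv P s else e with hV
  have hVn : ∀ s, ‖V s‖ = 1 := fun s => by
    by_cases h : ‖deriv P s‖ = 1
    · simp only [hV, if_pos h]; exact h
    · simp only [hV, if_neg h]; exact he
  have hVm : Measurable V :=
    Measurable.ite (measurableSet_eq_fun (measurable_deriv P).norm measurable_const)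
      (measurable_deriv P) measurable_const
  have hPd : Function.Periodic (deriv P) 1 := fun s => by
    rw [← deriv_comp_add_const]
    congr 1
    exact funext hPp
  have hVp : Function.Periodic V 1 := fun s => by simp only [hV, hPd s]
  have hVi : ∀ s t, ∫ x in s..t, V x = P t - P s := fun s t =>
    integral_eq_sub_of_ae_hasDerivAt (C := 1)
      hPlip.lipschitzOnWith.absolutelyContinuousOnInterval
      ((intervalIntegrable_const (c := (1 : ℝ))).mono_fun hVm.aestronglyMeasurable
        (Filter.Eventually.of_forall fun x => by simp [hVn x]))
      (fun x => (hVn x).le) (by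
        filter_upwards [hderiv] with x hx _
        simp only [hV, if_pos hx.1]
        exact hx.2)
  have hPi : ∀ s t, P s = P t → ∃ k : ℤ, s - t = k := fun s t hst => by
    obtain ⟨k, hk⟩ := hinj (σ.symm s) (σ.symm t)
      (smul_right_injective _ (inv_ne_zero hL.ne') hst)
    refine ⟨k, ?_⟩
    have h1 := hσz k (σ.symm t)
    rw [← hk, add_sub_cancel, σ.apply_symm_apply, σ.apply_symm_apply] at h1
    linarith
  refine ⟨⟨P, V, hPp, hVp, hVm, hVn, hVi, hPi⟩, fun s => rfl, ?_⟩
  filter_upwards [hgood] with u hu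
  refine ⟨hu.1, ?_⟩
  have h1 : ‖deriv P (σ u)‖ = 1 := by
    rw [hu.2.deriv, norm_smul, norm_inv, norm_norm, inv_mul_cancel₀ hu.1.ne']
  change _ = _ • V (σ u)
  simp only [hV, if_pos h1]
  rw [hu.2.deriv, smul_inv_smul₀ hu.1.ne']

theorem setLIntegral_comp_orderIso_mul {σ : ℝ ≃o ℝ}
    (hσz : ∀ (k : ℤ) t, σ (t + k) = σ t + k) (hσ0 : σ 0 = 0)
    (hσm : MeasurePreserving σ (volume.withDensity fun x => ENNReal.ofReal (‖γ.deriv' x‖ / L))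
      volume) {g : ℝ → ℝ≥0∞} (hg : Measurable g) :
    ∫⁻ t in Ioc (0 : ℝ) 1, g (σ t) * ENNReal.ofReal (‖γ.deriv' t‖ / L) =
      ∫⁻ s in Ioc (0 : ℝ) 1, g s := by
  have hpre : σ ⁻¹' Ioc (0 : ℝ) 1 = Ioc (0 : ℝ) 1 := by
    ext x
    have h1 : σ 1 = 1 := by simpa [hσ0] using hσz 1 0
    have h2 : 0 < σ x ↔ 0 < x := by
      conv_lhs => rw [← hσ0]
      exact σ.lt_iff_lt
    have h3 : σ x ≤ 1 ↔ x ≤ 1 := by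
      conv_lhs => rw [← h1]
      exact σ.le_iff_le
    rw [mem_preimage, mem_Ioc, mem_Ioc, h2, h3]
  have hm : Measurable fun t => g (σ t) := hg.comp σ.continuous.measurable
  rw [← hσm.setLIntegral_comp_preimage measurableSet_Ioc hg, hpre,
    restrict_withDensity measurableSet_Ioc,
    lintegral_withDensity_eq_lintegral_mul₀ (g := fun t => g (σ t))
      ((γ.intervalIntegrable_deriv' 0 1).norm.div_const
        L).1.aestronglyMeasurable.aemeasurable.ennreal_ofReal hm.aemeasurable]
  simp only [Pi.mul_apply, mul_comm]

theorem TP_eq_energy (hL : 0 < L) {σ : ℝ ≃o ℝ}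
    (hσz : ∀ (k : ℤ) t, σ (t + k) = σ t + k) (hσ0 : σ 0 = 0)
    (hσm : MeasurePreserving σ (volume.withDensity fun x => ENNReal.ofReal (‖γ.deriv' x‖ / L))
      volume) {Γ : UnitLoop n} (hpos : ∀ s, Γ.pos s = L⁻¹ • γ.toFun (σ.symm s))
    (hvel : ∀ᵐ t, 0 < ‖γ.deriv' t‖ ∧ γ.deriv' t = ‖γ.deriv' t‖ • Γ.vel (σ t)) {p q : ℝ}
    (hq : 0 < q) (hp : q < p) :
    TP p q γ = ENNReal.ofReal (L ^ (q + 2 - p)) * Γ.energy p q := by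
  have hpos' : ∀ t, γ.toFun t = L • Γ.pos (σ t) := fun t => by
    rw [hpos, smul_inv_smul₀ hL.ne', σ.symm_apply_apply]
  have hm1 : ∀ u, Measurable fun v : ℝ => Γ.energyDensity p q u v := fun u =>
    Γ.measurable_energyDensity p q (f := fun _ : ℝ => u) (g := fun v : ℝ => v) measurable_const
      measurable_id
  have hm2 : Measurable fun u : ℝ => ∫⁻ v in Ioc (0 : ℝ) 1, Γ.energyDensity p q u v := by
    have h : Measurable fun z : ℝ × ℝ => Γ.energyDensity p q z.1 z.2 :=
      Γ.measurable_energyDensity p q measurable_fst measurable_snd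
    exact h.lintegral_prod_right'
  have hinner : ∀ᵐ u, ∫⁻ w in Ioc (0 : ℝ) 1, ENNReal.ofReal
      (‖projPerp (γ.deriv' u) (γ.toFun (u + w) - γ.toFun u)‖ ^ q /
        ‖γ.toFun (u + w) - γ.toFun u‖ ^ p * (‖γ.deriv' u‖ * ‖γ.deriv' (u + w)‖)) =
      ENNReal.ofReal (L ^ (q + 2 - p)) * ((∫⁻ v in Ioc (0 : ℝ) 1, Γ.energyDensity p q (σ u) v) *
        ENNReal.ofReal (‖γ.deriv' u‖ / L)) := by
    filter_upwards [hvel] with u hu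
    have hpt : ∀ w, ENNReal.ofReal
        (‖projPerp (γ.deriv' u) (γ.toFun (u + w) - γ.toFun u)‖ ^ q /
          ‖γ.toFun (u + w) - γ.toFun u‖ ^ p * (‖γ.deriv' u‖ * ‖γ.deriv' (u + w)‖)) =
        ENNReal.ofReal (L ^ (q + 2 - p)) * ENNReal.ofReal (‖γ.deriv' u‖ / L) *
          (Γ.energyDensity p q (σ u) (σ (u + w)) * ENNReal.ofReal (‖γ.deriv' (u + w)‖ / L)) :=
        fun w => by
      have h1 : ∀ t, ‖γ.deriv' t‖ = L * (‖γ.deriv' t‖ / L) := fun t =>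
        (mul_div_cancel₀ _ hL.ne').symm
      have h2 : projPerp (γ.deriv' u) (γ.toFun (u + w) - γ.toFun u) =
          L • projPerp (Γ.vel (σ u)) (Γ.pos (σ (u + w)) - Γ.pos (σ u)) := by
        rw [hu.2, projPerp_smul_left hu.1.ne', hpos', hpos', ← smul_sub, projPerp_smul_right]
      have h3 : γ.toFun (u + w) - γ.toFun u = L • (Γ.pos (σ (u + w)) - Γ.pos (σ u)) := by
        rw [hpos', hpos', smul_sub]
      have h4 := ofReal_projPerp_integrand_eq Γ (c := ‖γ.deriv' u‖ / L)
        (d := ‖γ.deriv' (u + w)‖ / L) (u := σ u) (v := σ (u + w)) hq hp hL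
      rw [← h1, ← h1, ← h2, ← h3] at h4
      rw [h4, ENNReal.ofReal_mul (by positivity)]
      ring
    have hper : Function.Periodic (fun v => Γ.energyDensity p q (σ u) (σ v) *
        ENNReal.ofReal (‖γ.deriv' v‖ / L)) 1 := fun v => by
      have h1 := hσz 1 v
      rw [Int.cast_one] at h1
      simp only [UnitLoop.energyDensity]
      rw [h1, UnitLoop.sinAngle_add_one_right, UnitLoop.chord_add_one, γ.deriv'_periodic v]
    have h5 := setLIntegral_Ioc_comp_add hper u
    have h6 := γ.setLIntegral_comp_orderIso_mul hσz hσ0 hσm (hm1 (σ u))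
    simp only [hpt]
    rw [lintegral_const_mul' _ _ (ENNReal.mul_ne_top ENNReal.ofReal_ne_top ENNReal.ofReal_ne_top),
      h5, h6]
    ring
  have h7 := γ.setLIntegral_comp_orderIso_mul hσz hσ0 hσm hm2
  rw [TP, lintegral_congr_ae (ae_restrict_of_ae hinner),
    lintegral_const_mul' _ _ ENNReal.ofReal_ne_top, h7]
  rfl

theorem exists_unitLoop (hL : 0 < L) (hinj : γ.IsInj) (hreg : γ.IsRegular)
    (hlen : γ.length = L) :
    ∃ Γ : UnitLoop n, range Γ.pos = (fun x => L⁻¹ • x) '' range γ.toFun ∧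
      ∀ p q, 0 < q → q < p → TP p q γ = ENNReal.ofReal (L ^ (q + 2 - p)) * Γ.energy p q := by
  obtain ⟨σ, hσz, hσ0, hσi, hσm⟩ := γ.exists_orderIso_speed hL hreg hlen
  obtain ⟨Γ, hpos, hvel⟩ := γ.exists_unitLoop_pos_eq hL hinj hreg hσz hσi hσm
  refine ⟨Γ, ?_, fun p q hq hp => γ.TP_eq_energy hL hσz hσ0 hσm hpos hvel hq hp⟩
  rw [← range_comp, funext hpos]
  exact σ.symm.surjective.range_comp (fun t => L⁻¹ • γ.toFun t)

end ClosedCurve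

theorem Complex.norm_exp_I_mul_sub_exp_I_mul (a b : ℝ) :
    ‖Complex.exp (Complex.I * b) - Complex.exp (Complex.I * a)‖ = 2 * |Real.sin ((b - a) / 2)| := by
  have h1 : Complex.exp (Complex.I * b) - Complex.exp (Complex.I * a) =
      Complex.exp (Complex.I * a) * (Complex.exp (Complex.I * ((b - a : ℝ) : ℂ)) - 1) := by
    rw [mul_sub, mul_one, ← Complex.exp_add]
    congr 2
    push_cast
    ring
  rw [h1, norm_mul, mul_comm Complex.I, Complex.norm_exp_ofReal_mul_I, one_mul,
    Complex.norm_exp_I_mul_ofReal_sub_one, Real.norm_eq_abs, abs_mul, abs_two]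

theorem exists_exp_lift {z : ℝ → ℂ} {r : ℝ} (hr : 0 < r) (hz : LipschitzWith 1 z)
    (hn : ∀ t, ‖z t‖ = r) :
    ∃ ω : ℝ → ℝ, (∀ s t, IntervalIntegrable ω volume s t) ∧
      (∀ᵐ t, HasDerivAt z (Complex.I * ω t * z t) t) ∧
      ∀ t, z t = z 0 * Complex.exp (Complex.I * ((∫ x in (0 : ℝ)..t, ω x : ℝ) : ℂ)) := by
  set ω : ℝ → ℝ := fun t => (deriv z t * (starRingEnd ℂ) (z t)).im / r ^ 2 with hω
  have hωm : Measurable ω := by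
    have h1 : Measurable z := hz.continuous.measurable
    have h2 : Measurable fun t => (starRingEnd ℂ) (z t) :=
      Complex.continuous_conj.measurable.comp h1
    have h3 := (measurable_deriv z).mul h2
    exact (Complex.measurable_im.comp h3).div_const _
  have hωb : ∀ t, ‖ω t‖ ≤ r⁻¹ := fun t => by
    simp only [hω]
    rw [norm_div, norm_pow, Real.norm_of_nonneg hr.le, div_le_iff₀ (by positivity)]
    calc ‖(deriv z t * (starRingEnd ℂ) (z t)).im‖ ≤ ‖deriv z t * (starRingEnd ℂ) (z t)‖ :=
          Complex.abs_im_le_norm _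
      _ ≤ 1 * r := by
          rw [norm_mul, RCLike.norm_conj, hn]
          exact mul_le_mul_of_nonneg_right (norm_deriv_le_of_lipschitz hz) hr.le
      _ = r⁻¹ * r ^ 2 := by field_simp
  have hωi : ∀ s t, IntervalIntegrable ω volume s t := fun s t =>
    (intervalIntegrable_const (c := r⁻¹)).mono_fun hωm.aestronglyMeasurable
      (Filter.Eventually.of_forall fun x => (hωb x).trans (le_abs_self _))
  have hsq : ∀ t, z t * (starRingEnd ℂ) (z t) = (r : ℂ) ^ 2 := fun t => by
    rw [Complex.mul_conj, Complex.normSq_eq_norm_sq, hn]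
    push_cast
    rfl
  have hd : ∀ᵐ t, HasDerivAt z (Complex.I * ω t * z t) t := by
    filter_upwards [hz.ae_differentiableAt] with t ht
    have h1 := ht.hasDerivAt
    refine h1.congr_deriv ?_
    have h2 : HasDerivAt (fun s => z s * (starRingEnd ℂ) (z s))
        (deriv z t * (starRingEnd ℂ) (z t) + z t * (starRingEnd ℂ) (deriv z t)) t :=
      h1.mul (Complex.conjCLE.toContinuousLinearMap.hasFDerivAt.comp_hasDerivAt t h1)
    have h3 := h2.unique ((hasDerivAt_const t ((r : ℂ) ^ 2)).congr_of_eventuallyEq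
      (Filter.Eventually.of_forall hsq))
    have h4 : (deriv z t * (starRingEnd ℂ) (z t)).re = 0 := by
      have h5 := congrArg Complex.re h3
      simp only [Complex.add_re, Complex.mul_re, Complex.conj_re, Complex.conj_im,
        Complex.zero_re] at h5 ⊢
      linarith
    have h5 : deriv z t * (starRingEnd ℂ) (z t) = Complex.I * ω t * (r : ℂ) ^ 2 := by
      have h5' : ω t * r ^ 2 = (deriv z t * (starRingEnd ℂ) (z t)).im :=
        div_mul_cancel₀ _ (pow_pos hr 2).ne'
      rw [← Complex.re_add_im (deriv z t * (starRingEnd ℂ) (z t)), h4, ← h5']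
      push_cast
      ring
    have h6 : (r : ℂ) ^ 2 ≠ 0 := by exact_mod_cast (pow_pos hr 2).ne'
    refine mul_right_cancel₀ h6 ?_
    calc deriv z t * (r : ℂ) ^ 2 = deriv z t * (starRingEnd ℂ) (z t) * z t := by rw [← hsq t]; ring
      _ = _ := by rw [h5]; ring
  refine ⟨ω, hωi, hd, fun t => ?_⟩
  set θ : ℝ → ℝ := fun t => ∫ x in (0 : ℝ)..t, ω x with hθ
  have hθd : ∀ᵐ t, HasDerivAt θ (ω t) t := by
    filter_upwards [LocallyIntegrable.ae_hasDerivAt_integral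
      (ClosedCurve.locallyIntegrable_of_intervalIntegrable hωi)] with t ht using ht 0
  have hθl : ∀ s t, |θ s - θ t| ≤ r⁻¹ * |s - t| := fun s t => by
    simp only [hθ]
    rw [intervalIntegral.integral_interval_sub_left (hωi _ _) (hωi _ _)]
    exact intervalIntegral.norm_integral_le_of_norm_le_const fun x _ => hωb x
  have hel : LipschitzWith (Real.toNNReal r⁻¹) fun t => Complex.exp (Complex.I * ((-θ t : ℝ) : ℂ)) :=
    LipschitzWith.of_dist_le_mul fun s t => by
      rw [dist_eq_norm, Complex.norm_exp_I_mul_sub_exp_I_mul, Real.dist_eq,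
        Real.coe_toNNReal _ (by positivity)]
      have h1 := Real.abs_sin_le_abs (x := (-θ s - -θ t) / 2)
      rw [abs_div, abs_two, show -θ s - -θ t = -(θ s - θ t) by ring, abs_neg] at h1
      rw [show -θ s - -θ t = -(θ s - θ t) by ring]
      linarith [hθl s t]
  have hac1 : AbsolutelyContinuousOnInterval (fun t => Complex.exp (Complex.I * ((-θ t : ℝ) : ℂ)))
      0 t := hel.lipschitzOnWith.absolutelyContinuousOnInterval
  have hac2 : AbsolutelyContinuousOnInterval z 0 t :=
    hz.lipschitzOnWith.absolutelyContinuousOnInterval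
  have hac := hac1.smul hac2
  obtain ⟨K, hK⟩ := hac.const_of_ae_hasDerivAt_zero (by
    filter_upwards [hd, hθd] with s h1 h2 _
    have h3 : HasDerivAt (fun t => Complex.exp (Complex.I * ((-θ t : ℝ) : ℂ)))
        (Complex.exp (Complex.I * ((-θ s : ℝ) : ℂ)) * (Complex.I * ((-ω s : ℝ) : ℂ))) s :=
      (h2.neg.ofReal_comp.const_mul Complex.I).cexp
    have h4 := h3.smul h1
    refine h4.congr_deriv ?_
    simp only [smul_eq_mul]
    push_cast
    ring)
  have h0 := hK 0 left_mem_uIcc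
  have ht := hK t right_mem_uIcc
  have hθ0 : θ 0 = 0 := by simp [hθ]
  rw [Pi.smul_apply', smul_eq_mul] at h0 ht
  rw [hθ0] at h0
  simp only [neg_zero, Complex.ofReal_zero, mul_zero, Complex.exp_zero, one_mul] at h0
  rw [h0, ← ht, mul_right_comm, ← Complex.exp_add]
  simp [hθ]

theorem ae_nonneg_of_monotoneOn_integral {ω : ℝ → ℝ} (hi : ∀ s t, IntervalIntegrable ω volume s t)
    (h : MonotoneOn (fun t => ∫ x in (0 : ℝ)..t, ω x) (Ioo 0 1)) :
    ∀ᵐ t, t ∈ Ioo (0 : ℝ) 1 → 0 ≤ ω t := by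
  filter_upwards [LocallyIntegrable.ae_hasDerivAt_integral
    (ClosedCurve.locallyIntegrable_of_intervalIntegrable hi)] with t ht hm
  have h1 := h.derivWithin_nonneg (x := t)
  rwa [(ht 0).hasDerivWithinAt.derivWithin (isOpen_Ioo.uniqueDiffWithinAt hm)] at h1

theorem norm_sub_eq_of_circle {z : ℝ → ℂ} {r : ℝ} (hr : 0 < r) (hz : LipschitzWith 1 z)
    (hn : ∀ t, ‖z t‖ = r) (hd : ∀ᵐ t, ‖deriv z t‖ = 1) (h01 : z 1 = z 0)
    (hinj : ∀ s t, z s = z t → ∃ k : ℤ, s - t = k) :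
    2 * π * r = 1 ∧ ∀ u ∈ Icc (0 : ℝ) 1, ∀ v ∈ Icc (0 : ℝ) 1,
      ‖z v - z u‖ = |Real.sin (π * (v - u))| / π := by
  obtain ⟨ω, hωi, hωd, hzω⟩ := exists_exp_lift hr hz hn
  have habs : ∀ᵐ t, |ω t| = r⁻¹ := by
    filter_upwards [hωd, hd] with t h1 h2
    rw [h1.deriv, norm_mul, norm_mul, Complex.norm_I, one_mul, hn, Complex.norm_real,
      Real.norm_eq_abs] at h2
    exact eq_inv_of_mul_eq_one_left h2
  have hz0 : z 0 ≠ 0 := norm_pos_iff.1 (by rw [hn]; exact hr)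
  have hθc : Continuous fun t => ∫ x in (0 : ℝ)..t, ω x :=
    intervalIntegral.continuous_primitive hωi 0
  have hθinj : InjOn (fun t => ∫ x in (0 : ℝ)..t, ω x) (Ioo 0 1) := fun s hs t ht hst => by
    obtain ⟨k, hk⟩ := hinj s t (by rw [hzω s, hzω t]; simp only at hst; rw [hst])
    have h1 : (k : ℝ) < 1 := by rw [← hk]; linarith [hs.2, ht.1]
    have h2 : (-1 : ℝ) < k := by rw [← hk]; linarith [hs.1, ht.2]
    have h3 : k = 0 := by
      have h4 : k < 1 := by exact_mod_cast h1
      have h5 : -1 < k := by exact_mod_cast h2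
      omega
    rw [h3, Int.cast_zero] at hk
    linarith
  obtain ⟨ε, hε, hωε⟩ : ∃ ε : ℝ, |ε| = 1 ∧ ∀ᵐ t, t ∈ Ioo (0 : ℝ) 1 → ω t = ε * r⁻¹ := by
    rcases hθc.continuousOn.strictMonoOn_of_injOn_Ioo zero_lt_one hθinj with h | h
    · refine ⟨1, abs_one, ?_⟩
      filter_upwards [habs, ae_nonneg_of_monotoneOn_integral hωi h.monotoneOn] with t h1 h2 ht
      rw [one_mul, ← h1, abs_of_nonneg (h2 ht)]
    · refine ⟨-1, by simp, ?_⟩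
      have h' : MonotoneOn (fun t => ∫ x in (0 : ℝ)..t, -ω x) (Ioo 0 1) := by
        simp only [intervalIntegral.integral_neg]
        exact h.antitoneOn.neg
      filter_upwards [habs, ae_nonneg_of_monotoneOn_integral (fun s t => (hωi s t).neg) h']
        with t h1 h2 ht
      have h3 : 0 ≤ -ω t := h2 ht
      rw [← h1, abs_of_nonpos (by linarith)]
      ring
  have hθ : ∀ t ∈ Icc (0 : ℝ) 1, z t = z 0 * Complex.exp (Complex.I * ((ε * r⁻¹ * t : ℝ) : ℂ)) := by
    intro t ht
    rw [hzω t]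
    congr 4
    have h1 : ∫ x in (0 : ℝ)..t, ω x = ∫ x in (0 : ℝ)..t, ε * r⁻¹ := by
      refine intervalIntegral.integral_congr_ae ?_
      filter_upwards [hωε, Measure.ae_ne volume (1 : ℝ)] with x h1 h2 hx
      rw [uIoc_of_le ht.1] at hx
      exact h1 ⟨hx.1, lt_of_le_of_ne (hx.2.trans ht.2) h2⟩
    rw [h1, intervalIntegral.integral_const, smul_eq_mul]
    ring
  obtain ⟨k, hk⟩ : ∃ k : ℤ, ε * r⁻¹ = 2 * π * k := by
    have h1 := hθ 1 ⟨zero_le_one, le_rfl⟩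
    rw [h01] at h1
    obtain ⟨k, hk⟩ := Complex.exp_eq_one_iff.1 (mul_eq_left₀ hz0 |>.1 h1.symm)
    refine ⟨k, ?_⟩
    have h2 : Complex.I * ((ε * r⁻¹ * 1 : ℝ) : ℂ) = Complex.I * ((2 * π * k : ℝ) : ℂ) := by
      rw [hk]; push_cast; ring
    have h3 := mul_left_cancel₀ Complex.I_ne_zero h2
    rw [mul_one] at h3
    exact_mod_cast h3
  have hk0 : 0 < |(k : ℝ)| := by
    rw [abs_pos]
    intro h
    rw [h, mul_zero] at hk
    have h1 : ε ≠ 0 := fun h => by simp [h] at hε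
    exact mul_ne_zero h1 (inv_ne_zero hr.ne') hk
  have hk1 : |(k : ℝ)| = 1 := by
    have hk1 : 1 ≤ |(k : ℝ)| := by
      have h1 : 0 < |k| := by exact_mod_cast hk0
      exact_mod_cast h1
    have hm : |(k : ℝ)|⁻¹ ∈ Icc (0 : ℝ) 1 := ⟨by positivity, inv_le_one_of_one_le₀ hk1⟩
    obtain ⟨m, hm'⟩ := hinj |(k : ℝ)|⁻¹ 0 (by
      rw [hθ _ hm]
      refine mul_eq_left₀ hz0 |>.2 ?_
      rw [Complex.exp_eq_one_iff]
      rcases abs_choice (k : ℝ) with h | h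
      · refine ⟨1, ?_⟩
        rw [hk, h]
        rw [h] at hk0
        have : (k : ℂ) ≠ 0 := by exact_mod_cast hk0.ne'
        push_cast
        field_simp
      · refine ⟨-1, ?_⟩
        rw [hk, h]
        rw [h] at hk0
        have : (k : ℂ) ≠ 0 := by
          have : (k : ℝ) ≠ 0 := by linarith
          exact_mod_cast this
        push_cast
        field_simp)
    rw [sub_zero] at hm'
    have h2 : (0 : ℝ) < m := by rw [← hm']; positivity
    have h3 : (1 : ℝ) ≤ m := by
      have : 0 < m := by exact_mod_cast h2
      exact_mod_cast this
    have h4 : |(k : ℝ)|⁻¹ = 1 := le_antisymm hm.2 (hm'.symm ▸ h3)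
    exact inv_eq_one.1 h4
  have hr1 : 2 * π * r = 1 := by
    have h1 := congrArg abs hk
    rw [abs_mul, abs_mul, hε, hk1, abs_of_pos (inv_pos.2 hr), abs_of_pos (by positivity), one_mul,
      mul_one] at h1
    rw [← h1, inv_mul_cancel₀ hr.ne']
  refine ⟨hr1, fun u hu v hv => ?_⟩
  rw [hθ u hu, hθ v hv, ← mul_sub, norm_mul, hn, Complex.norm_exp_I_mul_sub_exp_I_mul, hk]
  have h1 : |Real.sin ((2 * π * k * v - 2 * π * k * u) / 2)| = |Real.sin (π * (v - u))| := by
    rcases eq_or_eq_neg_of_abs_eq hk1 with h | h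
    · rw [h]; congr 2; ring
    · rw [h, ← abs_neg, ← Real.sin_neg]; congr 2; ring
  rw [h1, eq_div_iff Real.pi_ne_zero]
  linear_combination |Real.sin (π * (v - u))| * hr1

theorem real_inner_eq_complex (x y : ℂ) : ⟪x, y⟫ = x.re * y.re + x.im * y.im := by
  rw [Complex.inner]
  simp [Complex.mul_re]
  ring

theorem one_sub_sq_inner_div_norm_eq {z w : ℂ} {r ω : ℝ} (hz : ‖z‖ = r) (hw : ‖w‖ = r)
    (hr : 0 < r) (hω : ‖Complex.I * ω * z‖ = 1) (hzw : w - z ≠ 0) :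
    1 - (⟪Complex.I * ω * z, w - z⟫ / ‖w - z‖) ^ 2 = (‖w - z‖ / (2 * r)) ^ 2 := by
  have h1 : z.re * z.re + z.im * z.im = r ^ 2 := by
    rw [← hz, Complex.sq_norm, Complex.normSq_apply]
  have h2 : w.re * w.re + w.im * w.im = r ^ 2 := by
    rw [← hw, Complex.sq_norm, Complex.normSq_apply]
  have h3 : ω ^ 2 * r ^ 2 = 1 := by
    rw [norm_mul, norm_mul, Complex.norm_I, Complex.norm_real, one_mul, hz, Real.norm_eq_abs] at hω
    rw [← sq_abs ω, ← mul_pow, hω, one_pow]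
  have h4 : ‖w - z‖ ^ 2 = (w.re - z.re) * (w.re - z.re) + (w.im - z.im) * (w.im - z.im) := by
    rw [Complex.sq_norm, Complex.normSq_apply, Complex.sub_re, Complex.sub_im]
  have h5 : ⟪Complex.I * ω * z, w - z⟫ = ω * (z.re * w.im - z.im * w.re) := by
    rw [real_inner_eq_complex]
    simp
    ring
  have h6 : 0 < ‖w - z‖ := norm_pos_iff.2 hzw
  have h7 : 4 * r ^ 2 * (‖w - z‖ ^ 2 - ⟪Complex.I * ω * z, w - z⟫ ^ 2) = (‖w - z‖ ^ 2) ^ 2 := by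
    rw [h5, mul_pow]
    have h8 : ‖w - z‖ ^ 2 = 2 * r ^ 2 - 2 * (z.re * w.re + z.im * w.im) := by
      rw [h4]; linear_combination h1 + h2
    have h9 : (z.re * w.im - z.im * w.re) ^ 2 = r ^ 4 - (z.re * w.re + z.im * w.im) ^ 2 := by
      linear_combination (w.re * w.re + w.im * w.im) * h1 + r ^ 2 * h2
    rw [h8, h9]
    linear_combination (-4 * (r ^ 4 - (z.re * w.re + z.im * w.im) ^ 2)) * h3
  rw [div_pow, div_pow, one_sub_div (pow_pos h6 2).ne', div_eq_div_iff (by positivity)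
    (by positivity)]
  linear_combination h7

namespace UnitLoop

variable {n : ℕ} (γ : UnitLoop n)

theorem exists_complex_coordinates (h : IsCircle (range γ.pos)) :
    ∃ (r : ℝ) (z : ℝ → ℂ), 0 < r ∧ (∀ t, ‖z t‖ = r) ∧ (∀ u v, γ.chord u v = ‖z v - z u‖) ∧
      ∀ᵐ u, ‖deriv z u‖ = 1 ∧ ∀ v, ⟪γ.vel u, γ.pos v - γ.pos u⟫ = ⟪deriv z u, z v - z u⟫ := by
  obtain ⟨c, r, V, hr, hV, hS⟩ := h
  have hmem : ∀ t, ‖γ.pos t - c‖ = r ∧ γ.pos t - c ∈ V := fun t => by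
    have h1 : γ.pos t ∈ range γ.pos := mem_range_self t
    rwa [hS] at h1
  let φ : ℂ ≃ₗᵢ[ℝ] V :=
    Complex.isometryOfOrthonormal ((stdOrthonormalBasis ℝ V).reindex (finCongr hV))
  let A : EuclideanSpace ℝ (Fin n) →L[ℝ] ℂ :=
    φ.symm.toContinuousLinearEquiv.toContinuousLinearMap.comp V.orthogonalProjectionOnto
  have hA : ∀ x ∈ V, ∀ y ∈ V, ⟪A x, A y⟫ = ⟪x, y⟫ := fun x hx y hy => by
    have h1 : V.orthogonalProjectionOnto x = ⟨x, hx⟩ :=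
      V.orthogonalProjectionOnto_mem_subspace_eq_self ⟨x, hx⟩
    have h2 : V.orthogonalProjectionOnto y = ⟨y, hy⟩ :=
      V.orthogonalProjectionOnto_mem_subspace_eq_self ⟨y, hy⟩
    change ⟪φ.symm (V.orthogonalProjectionOnto x), φ.symm (V.orthogonalProjectionOnto y)⟫ = _
    rw [φ.symm.inner_map_map, h1, h2]
    rfl
  have hAn : ∀ x ∈ V, ‖A x‖ = ‖x‖ := fun x hx => by
    rw [norm_eq_sqrt_real_inner, hA x hx x hx, ← norm_eq_sqrt_real_inner]
  have hsub : ∀ u v, γ.pos v - γ.pos u ∈ V := fun u v => by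
    rw [← sub_sub_sub_cancel_right _ _ c]
    exact V.sub_mem (hmem v).2 (hmem u).2
  have hz : ∀ u v, A (γ.pos v - c) - A (γ.pos u - c) = A (γ.pos v - γ.pos u) := fun u v => by
    rw [← map_sub, sub_sub_sub_cancel_right]
  refine ⟨r, fun t => A (γ.pos t - c), hr, fun t => ?_, fun u v => ?_, ?_⟩
  · rw [hAn _ (hmem t).2, (hmem t).1]
  · simp only [hz]
    rw [hAn _ (hsub u v)]
    rfl
  filter_upwards [γ.ae_hasDerivAt_pos] with u hu
  have h1 : HasDerivAt (fun t => γ.pos t - c) (γ.vel u) u := hu.sub_const c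
  have h2 : HasDerivAt (fun t => γ.pos t - c) (V.starProjection (γ.vel u)) u :=
    (V.starProjection.hasFDerivAt.comp_hasDerivAt u h1).congr_of_eventuallyEq
      (Filter.Eventually.of_forall fun t =>
        (Submodule.starProjection_eq_self_iff.2 (hmem t).2).symm)
  have h3 : γ.vel u ∈ V := Submodule.starProjection_eq_self_iff.1 (h2.unique h1)
  have h4 : HasDerivAt (fun t => A (γ.pos t - c)) (A (γ.vel u)) u :=
    A.hasFDerivAt.comp_hasDerivAt u h1
  rw [h4.deriv]
  refine ⟨by rw [hAn _ h3, γ.norm_vel], fun v => ?_⟩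
  rw [hz, hA _ h3 _ (hsub u v)]

theorem chord_sinAngle_of_isCircle (h : IsCircle (range γ.pos)) :
    (∀ u ∈ Icc (0 : ℝ) 1, ∀ v ∈ Icc (0 : ℝ) 1, γ.chord u v = |Real.sin (π * (v - u))| / π) ∧
      ∀ᵐ u, ∀ v, γ.chord u v ≠ 0 → γ.sinAngle u v = π * γ.chord u v := by
  obtain ⟨r, z, hr, hn, hch, hd⟩ := γ.exists_complex_coordinates h
  have hlip : LipschitzWith 1 z := LipschitzWith.of_dist_le_mul fun s t => by
    rw [dist_eq_norm, ← hch, chord, ← dist_eq_norm]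
    exact γ.lipschitzWith_pos.dist_le_mul s t
  have hz : ∀ s t, z s = z t ↔ γ.pos s = γ.pos t := fun s t => by
    rw [← sub_eq_zero, ← norm_eq_zero, ← hch, chord, norm_eq_zero, sub_eq_zero]
  obtain ⟨hr1, hc⟩ := norm_sub_eq_of_circle hr hlip hn (hd.mono fun u hu => hu.1)
    ((hz 1 0).2 (by simpa using γ.pos_periodic 0))
    (fun s t hst => γ.exists_int_of_pos_eq s t ((hz s t).1 hst))
  refine ⟨fun u hu v hv => by rw [hch, hc u hu v hv], ?_⟩
  obtain ⟨ω, -, hωd, -⟩ := exists_exp_lift hr hlip hn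
  filter_upwards [hd, hωd] with u h1 h2 v hv
  have h3 : z v - z u ≠ 0 := by rwa [hch, norm_ne_zero_iff] at hv
  have h4 := h1.1
  rw [h2.deriv] at h4
  have h5 := one_sub_sq_inner_div_norm_eq (hn u) (hn v) hr h4 h3
  rw [sinAngle, ← chord, h1.2, h2.deriv, hch, h5, Real.sqrt_sq (by positivity), div_eq_iff
    (by positivity)]
  linear_combination -‖z v - z u‖ * hr1

theorem energy_of_isCircle (h : IsCircle (range γ.pos)) {p q : ℝ}
    (ha : -1 < 2 * q - p) :
    γ.energy p q =
      ENNReal.ofReal (π ^ (p - q) * ∫ w in (0 : ℝ)..1, Real.sin (π * w) ^ (2 * q - p)) := by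
  obtain ⟨hc, hs⟩ := γ.chord_sinAngle_of_isCircle h
  have hinner : ∀ᵐ u, u ∈ Ioc (0 : ℝ) 1 → ∫⁻ v in Ioc (0 : ℝ) 1, γ.energyDensity p q u v =
      ENNReal.ofReal (π ^ (p - q) * ∫ w in (0 : ℝ)..1, Real.sin (π * w) ^ (2 * q - p)) := by
    filter_upwards [hs, Measure.ae_ne volume (1 : ℝ)] with u hsu hu1 hu
    have hpt : ∀ᵐ v, v ∈ Ioc (0 : ℝ) 1 → γ.energyDensity p q u v = ENNReal.ofReal (π ^ (p - q)) *
        ENNReal.ofReal (|Real.sin (π * (v - u))| ^ (2 * q - p)) := by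
      filter_upwards [Measure.ae_ne volume u, Measure.ae_ne volume (1 : ℝ)] with v hv hv1 hvI
      have h1 : 0 < γ.chord u v := by
        rcases lt_or_gt_of_ne hv with h | h
        · rw [γ.chord_comm]
          exact γ.chord_pos h (by linarith [hu.2, hvI.1])
        · exact γ.chord_pos h (by linarith [hu.1, hvI.2])
      have h2 := hc u (Ioc_subset_Icc_self hu) v (Ioc_subset_Icc_self hvI)
      rw [energyDensity, hsu v h1.ne', ← ENNReal.ofReal_mul (by positivity)]
      congr 1
      have h3 : 0 < |Real.sin (π * (v - u))| := by
        rw [h2] at h1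
        by_contra h
        rw [le_antisymm (not_lt.1 h) (abs_nonneg _), zero_div] at h1
        exact lt_irrefl _ h1
      rw [h2, mul_div_cancel₀ _ Real.pi_ne_zero, Real.div_rpow h3.le Real.pi_pos.le,
        show p - q = -(q - p) by ring, Real.rpow_neg Real.pi_pos.le,
        show 2 * q - p = q + (q - p) by ring, Real.rpow_add h3]
      ring
    have hper : Function.Periodic
        (fun v => ENNReal.ofReal (|Real.sin (π * (v - u))| ^ (2 * q - p))) 1 := fun v => by
      simp only
      rw [show π * (v + 1 - u) = π * (v - u) + π by ring, Real.sin_add_pi, abs_neg]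
    have h4 := setLIntegral_Ioc_comp_add hper u
    simp only [add_sub_cancel_left] at h4
    rw [setLIntegral_congr_fun_ae measurableSet_Ioc hpt,
      lintegral_const_mul' _ _ ENNReal.ofReal_ne_top, ← h4, ENNReal.ofReal_mul (by positivity),
      ← lintegral_sin_rpow_eq_ofReal ha]
    congr 1
    refine setLIntegral_congr_fun measurableSet_Ioc fun w hw => ?_
    rw [abs_of_nonneg (sin_pi_mul_nonneg hw)]
  rw [energy, setLIntegral_congr_fun_ae measurableSet_Ioc hinner, setLIntegral_const,
    Real.volume_Ioc]
  simp

end UnitLoop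

theorem IsCircle.image_smul {F : Type*} [NormedAddCommGroup F] [InnerProductSpace ℝ F] {S : Set F}
    (h : IsCircle S) {a : ℝ} (ha : 0 < a) : IsCircle ((fun x => a • x) '' S) := by
  obtain ⟨c, r, V, hr, hV, rfl⟩ := h
  refine ⟨a • c, a * r, V, mul_pos ha hr, hV, ?_⟩
  ext x
  rw [mem_image]
  constructor
  · rintro ⟨y, ⟨h1, h2⟩, rfl⟩
    simp only [mem_ofPred_eq]
    rw [← smul_sub, norm_smul, h1, Real.norm_of_nonneg ha.le]
    exact ⟨rfl, V.smul_mem _ h2⟩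
  · rintro ⟨h1, h2⟩
    have h3 : a⁻¹ • x - c = a⁻¹ • (x - a • c) := by rw [smul_sub, inv_smul_smul₀ ha.ne']
    refine ⟨a⁻¹ • x, ⟨?_, ?_⟩, smul_inv_smul₀ ha.ne' x⟩
    · rw [h3, norm_smul, h1, norm_inv, Real.norm_of_nonneg ha.le, inv_mul_cancel_left₀ ha.ne']
    · rw [h3]
      exact V.smul_mem _ h2

/-- **Sharp lower bound for the generalized tangent-point energies** (Theorem 1.1).
For `q ≥ 1`, `p ∈ [q+1, 2q+1) ∩ [2q−2, 4q−2]` or `p = q+1`, every injective regular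
closed `W^{1,1}`-curve of length `L` satisfies
`TP^{(p,q)}(γ) ≥ L^{q+2−p} π^{p−q} ∫₀¹ sin(πw)^{2q−p} dw`, the latter integral being
`Γ((2q−p+1)/2)/(√π Γ((2q−p+2)/2))`; equality holds if the image of `γ` is a circle. -/
theorem tp_sharp_lower_bound {n : ℕ} (p q L : ℝ) (hq : 1 ≤ q)
    (hp : (q + 1 ≤ p ∧ p < 2 * q + 1 ∧ 2 * q - 2 ≤ p ∧ p ≤ 4 * q - 2) ∨ p = q + 1)
    (hL : 0 < L) (γ : ClosedCurve n) (hinj : γ.IsInj) (hreg : γ.IsRegular)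
    (hlen : γ.length = L) :
    ENNReal.ofReal (L ^ (q + 2 - p) * π ^ (p - q) * ∫ w in (0:ℝ)..1, Real.sin (π * w) ^ (2 * q - p)) ≤ TP p q γ ∧
    (∫ w in (0:ℝ)..1, Real.sin (π * w) ^ (2 * q - p)) =
      Real.Gamma ((2 * q - p + 1) / 2) / (Real.sqrt π * Real.Gamma ((2 * q - p + 2) / 2)) ∧
    (IsCircle (Set.range γ.toFun) →
      TP p q γ = ENNReal.ofReal (L ^ (q + 2 - p) * π ^ (p - q) * ∫ w in (0:ℝ)..1, Real.sin (π * w) ^ (2 * q - p))) := by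
  have hqp : q < p := by rcases hp with h | h <;> linarith [h]
  have ha : -1 < 2 * q - p := by rcases hp with h | h <;> linarith [h]
  have hI := integral_sin_rpow_nonneg (2 * q - p)
  obtain ⟨Γ, hΓ, hTP⟩ := γ.exists_unitLoop hL hinj hreg hlen
  rw [hTP p q (by linarith) hqp, mul_assoc, ENNReal.ofReal_mul (by positivity)]
  refine ⟨mul_le_mul_right ?_ _, integral_sin_rpow_eq_Gamma ha, fun hc => ?_⟩
  · rcases hp with ⟨h1, h2, h3, h4⟩ | h
    · rcases le_total 0 (2 * q - p) with h5 | h5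
      · exact Γ.le_energy_of_nonneg hq h1 h5 (Or.inl (by linarith))
      · exact Γ.le_energy_of_nonpos hq (by linarith) h2 h4
    · exact Γ.le_energy_of_nonneg hq h.ge (by linarith) (Or.inr h)
  · rw [Γ.energy_of_isCircle (hΓ ▸ hc.image_smul (inv_pos.2 hL)) ha]

end
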